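/- arXiv:2001.05051 — 3 statements merged into one kernel-verified Lean document; each statement's English description precedes it below -/
import Mathlib

section
/- If G is a finite simple graph and k is an integer with k > Δ(G), then G has a proper k-coloring with color classes A_1, ..., A_k such that the sizes of any two color classes differ by at most 1 (i.e., ||A_i| − |A_j|| ≤ 1 for all i, j). -/
open SimpleGraph

namespace EquitableColoring

section Reaches

variable {ι : Type*} {R R' : ι → ι → Prop} {p p' : ι → Prop} {a b i : ι}

/-- `Reaches R p a i` says that there is an `R`-path from `i` to `a` all of whose vertices
satisfy `p`. -/
inductive Reaches (R : ι → ι → Prop) (p : ι → Prop) (a : ι) : ι → Prop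
  | base : p a → Reaches R p a a
  | step {i j : ι} : p i → R i j → Reaches R p a j → Reaches R p a i

theorem Reaches.prop (h : Reaches R p a i) : p i := by
  cases h <;> assumption

theorem Reaches.mono (h : Reaches R p a i) (hR : ∀ i j, p i → p j → R i j → R' i j)
    (hp : ∀ i, p i → p' i) : Reaches R' p' a i := by
  induction h with
  | base ha => exact .base (hp _ ha)
  | step hi hij hj ih => exact .step (hp _ hi) (hR _ _ hi hj.prop hij) ih

/-- If `i` reaches `a` inside `p`, then all vertices of the path reach `a`. -/
theorem Reaches.strengthen (h : Reaches R p a i) : Reaches R (Reaches R p a) a i := by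
  induction h with
  | base ha => exact .base (.base ha)
  | step hi hij hj ih => exact .step (.step hi hij hj) hij ih

theorem Reaches.avoid_or_exit (h : Reaches R p a i) (hab : b ≠ a) :
    Reaches R (fun x => p x ∧ x ≠ b) a i ∨
      ∃ j, R b j ∧ Reaches R (fun x => p x ∧ x ≠ b) a j := by
  induction h with
  | base ha => exact .inl (.base ⟨ha, hab.symm⟩)
  | @step i j hi hij hj ih =>
    rcases ih with ih | ih
    · by_cases hib : i = b
      · exact .inr ⟨j, hib ▸ hij, ih⟩
      · exact .inl (.step ⟨hi, hib⟩ hij ih)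
    · exact .inr ih

/-- A path from `b` to `a ≠ b` can be taken not to return to `b`. -/
theorem Reaches.exists_exit (h : Reaches R p a b) (hab : b ≠ a) :
    ∃ j, R b j ∧ Reaches R (fun x => p x ∧ x ≠ b) a j :=
  (h.avoid_or_exit hab).elim (fun h' => absurd rfl h'.prop.2) id

open Classical in
/-- Among the vertices that reach `a`, there is a vertex `u` and a nonempty set `T` all of whose
members are terminal (deleting one does not disconnect any other vertex from `a`), such that edges
leaving `T` can only go to `u`. -/
theorem exists_terminal_set (A : Finset ι) (hA : ∀ i ∈ A, Reaches R (· ∈ A) a i)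
    (ha : a ∈ A) (hne : ∃ i ∈ A, i ≠ a) :
    ∃ u ∈ A, ∃ T ⊆ A, T.Nonempty ∧ a ∉ T ∧ u ∉ T ∧
      (∀ x ∈ T, ∀ i ∈ A, i ≠ x → Reaches R (fun j => j ∈ A ∧ j ≠ x) a i) ∧
      ∀ x ∈ T, ∀ j ∈ A, R x j → j = u ∨ j ∈ T := by
  let T : ι → Finset ι := fun u => {i ∈ A | i ≠ u ∧ ¬ Reaches R (fun j => j ∈ A ∧ j ≠ u) a i}
  have hmT : ∀ u i, i ∈ T u ↔ i ∈ A ∧ i ≠ u ∧ ¬ Reaches R (fun j => j ∈ A ∧ j ≠ u) a i :=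
    fun u i => Finset.mem_filter
  have hTa : (T a).Nonempty := by
    obtain ⟨i, hi, hia⟩ := hne
    refine ⟨i, (hmT _ _).2 ⟨hi, hia, fun h => ?_⟩⟩
    have key : ∀ {x}, Reaches R (fun j => j ∈ A ∧ j ≠ a) a x → False := by
      intro x hx
      induction hx with
      | base h => exact h.2 rfl
      | step _ _ _ ih => exact ih
    exact key h
  obtain ⟨u, hu, hmin⟩ := Finset.exists_min_image (A.filter fun u => (T u).Nonempty)
    (fun u => (T u).card) ⟨a, by simp [ha, hTa]⟩
  simp only [Finset.mem_filter] at hu hmin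
  have haT : a ∉ T u := fun h =>
    ((hmT _ _).1 h).2.2 (.base ⟨ha, ((hmT _ _).1 h).2.1⟩)
  refine ⟨u, hu.1, T u, Finset.filter_subset _ _, hu.2, haT,
    fun h => ((hmT _ _).1 h).2.1 rfl, ?_, ?_⟩
  · intro x hx i hi hix
    by_contra hcon
    have hxT := (hmT _ _).1 hx
    have avoid : ∀ {v}, Reaches R (fun j => j ∈ A ∧ j ≠ u) a v →
        Reaches R (fun j => j ∈ A ∧ j ≠ x) a v := fun {v} hv =>
      hv.strengthen.mono (fun _ _ _ _ h => h) fun k hk =>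
        ⟨hk.prop.1, fun hkx => hxT.2.2 (hkx ▸ hk)⟩
    have hsub : T x ⊂ T u := by
      refine (Finset.ssubset_iff_of_subset ?_).2 ⟨x, hx, fun h => ((hmT _ _).1 h).2.1 rfl⟩
      intro v hv
      have hv' := (hmT _ _).1 hv
      refine (hmT _ _).2 ⟨hv'.1, ?_, fun h => hv'.2.2 (avoid h)⟩
      rintro rfl
      by_cases hva : v = a
      · subst hva
        exact hv'.2.2 (.base ⟨ha, hv'.2.1⟩)
      · obtain ⟨j, hj, hj'⟩ := (hA v hv'.1).exists_exit hva
        exact hv'.2.2 (.step ⟨hv'.1, hv'.2.1⟩ hj (avoid hj'))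
    exact absurd (hmin x ⟨hxT.1, i, (hmT _ _).2 ⟨hi, hix, hcon⟩⟩)
      (not_le.2 (Finset.card_lt_card hsub))
  · intro x hx j hj hxj
    have hxT := (hmT _ _).1 hx
    by_contra! hcon
    have hjr : Reaches R (fun j => j ∈ A ∧ j ≠ u) a j := by
      by_contra h
      exact hcon.2 ((hmT _ _).2 ⟨hj, hcon.1, h⟩)
    exact hxT.2.2 (.step ⟨hxT.1, hxT.2.1⟩ hxj hjr)

end Reaches

section Coloring

open scoped Classical

variable {V ι : Type*} {G : SimpleGraph V} {S : Finset V} {K : Finset ι} {s : ℕ}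
  {c c' : V → ι} {a b i j : ι}

/-- `c` colors `S` properly with colors from `K`, and all classes have size `s`, except that one
vertex is missing in class `a` and there is one vertex too many in class `b`
(no exception if `a = b`). -/
structure NearlyUniform (G : SimpleGraph V) (S : Finset V) (K : Finset ι) (s : ℕ) (c : V → ι)
    (a b : ι) : Prop where
  mem : ∀ v ∈ S, c v ∈ K
  proper : ∀ u ∈ S, ∀ v ∈ S, G.Adj u v → c u ≠ c v
  card_class : ∀ i ∈ K,
    (S.filter (c · = i)).card + (if i = a then 1 else 0) = s + (if i = b then 1 else 0)

/-- `c` colors `S` properly with colors from `K`, and all classes have size `s`. -/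
structure Uniform (G : SimpleGraph V) (S : Finset V) (K : Finset ι) (s : ℕ) (c : V → ι) :
    Prop where
  mem : ∀ v ∈ S, c v ∈ K
  proper : ∀ u ∈ S, ∀ v ∈ S, G.Adj u v → c u ≠ c v
  card_class : ∀ i ∈ K, (S.filter (c · = i)).card = s

theorem NearlyUniform.uniform (h : NearlyUniform G S K s c a a) : Uniform G S K s c :=
  ⟨h.mem, h.proper, fun i hi => by simpa using h.card_class i hi⟩

/-- Some vertex of color `i` can be moved to the class of color `j`. -/
def Movable (G : SimpleGraph V) (S : Finset V) (c : V → ι) (i j : ι) : Prop :=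
  i ≠ j ∧ ∃ y ∈ S, c y = i ∧ ∀ w ∈ S, c w = j → ¬ G.Adj y w

theorem Movable.congr (h : Movable G S c i j) (hi : ∀ v ∈ S, c v = i → c' v = i)
    (hj : ∀ v ∈ S, c' v = j → c v = j) : Movable G S c' i j := by
  obtain ⟨hij, y, hy, hyi, hyj⟩ := h
  exact ⟨hij, y, hy, hi y hy hyi, fun w hw hwj => hyj w hw (hj w hw hwj)⟩

theorem card_class_update
    (h : ∀ i ∈ K,
      (S.filter (c · = i)).card + (if i = a then 1 else 0) = s + (if i = b then 1 else 0))
    {y : V} (hy : y ∈ S) (hyb : c y = b) :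
    ∀ i ∈ K, (S.filter (Function.update c y j · = i)).card + (if i = a then 1 else 0) =
      s + (if i = j then 1 else 0) := by
  intro i hi
  have h1 := h i hi
  have e1 : ∀ f : V → ι, (S.filter (f · = i)).card =
      ((S.erase y).filter (f · = i)).card + (if f y = i then 1 else 0) := by
    intro f
    conv_lhs => rw [← Finset.insert_erase hy, Finset.filter_insert]
    split_ifs
    · rw [Finset.card_insert_of_notMem (by simp)]
    · rfl
  have e2 : (S.erase y).filter (Function.update c y j · = i) = (S.erase y).filter (c · = i) := by
    refine Finset.filter_congr fun v hv => ?_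
    rw [Function.update_of_ne (Finset.ne_of_mem_erase hv)]
  rw [e1, e2, Function.update_self]
  rw [e1, hyb] at h1
  simp only [eq_comm (a := b), eq_comm (a := j)] at h1 ⊢
  omega

theorem NearlyUniform.update (h : NearlyUniform G S K s c a b) {y : V} (hy : y ∈ S)
    (hyb : c y = b) (hj : j ∈ K) (hyj : ∀ w ∈ S, c w = j → ¬ G.Adj y w) :
    NearlyUniform G S K s (Function.update c y j) a j := by
  refine ⟨fun v hv => ?_, fun u hu v hv huv => ?_, card_class_update h.card_class hy hyb⟩
  · by_cases hvy : v = y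
    · simpa [hvy] using hj
    · simpa [hvy] using h.mem v hv
  · by_cases huy : u = y
    · subst huy
      have := huv.ne'
      simp only [Function.update_self, Function.update_of_ne this]
      exact fun hcv => hyj v hv hcv.symm huv
    · by_cases hvy : v = y
      · subst hvy
        simp only [Function.update_self, Function.update_of_ne huy]
        exact fun hcu => hyj u hu hcu huv.symm
      · simpa [huy, hvy] using h.proper u hu v hv huv

/-- Shifting vertices along a path from the large class to the small class. -/
theorem NearlyUniform.exists_uniform_of_path (F : Finset ι) :
    ∀ {c : V → ι} {b : ι}, NearlyUniform G S K s c a b → F ⊆ K → b ∉ F →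
      (b = a ∨ ∃ j, Movable G S c b j ∧ Reaches (Movable G S c) (· ∈ F) a j) →
      ∃ c' : V → ι, Uniform G S K s c' := by
  induction F using Finset.strongInduction with
  | H F ih =>
    intro c b h hFK hbF hb
    rcases hb with rfl | ⟨j, hbj, hj⟩
    · exact ⟨c, h.uniform⟩
    have hjF : j ∈ F := hj.prop
    obtain ⟨hbj', y, hy, hyb, hyj⟩ := hbj
    have transfer : ∀ k l, k ≠ b → l ≠ b → l ≠ j → Movable G S c k l →
        Movable G S (Function.update c y j) k l := by
      intro k l hk hl hlj hkl
      refine hkl.congr (fun v _ hvk => ?_) (fun v _ hvl => ?_)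
      · rw [Function.update_of_ne, hvk]
        rintro rfl
        exact hk (hvk.symm.trans hyb)
      · by_cases hvy : v = y
        · subst hvy
          rw [Function.update_self] at hvl
          exact absurd hvl.symm hlj
        · rwa [Function.update_of_ne hvy] at hvl
    refine ih (F.erase j) (Finset.erase_ssubset hjF) (h.update hy hyb (hFK hjF) hyj)
      ((Finset.erase_subset _ _).trans hFK) (Finset.notMem_erase _ _) ?_
    by_cases hja : j = a
    · exact .inl hja
    obtain ⟨l, hjl, hl⟩ := hj.exists_exit hja
    have hne : ∀ k ∈ F, k ≠ b := fun k hk hkb => hbF (hkb ▸ hk)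
    refine .inr ⟨l, transfer j l hbj'.symm (hne _ hl.prop.1) hl.prop.2 hjl,
      hl.mono (fun k m hk hm => transfer k m (hne k hk.1) (hne m hm.1) hm.2) ?_⟩
    exact fun k hk => Finset.mem_erase.2 hk.symm

/-- The number of neighbors of `v` in the class of color `i`. -/
noncomputable def nbrCount (G : SimpleGraph V) (S : Finset V) (c : V → ι) (v : V) (i : ι) : ℕ :=
  (S.filter fun w => c w = i ∧ G.Adj v w).card

theorem sum_nbrCount (J : Finset ι) (v : V) :
    ∑ i ∈ J, nbrCount G S c v i = (S.filter fun w => c w ∈ J ∧ G.Adj v w).card := by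
  rw [Finset.card_eq_sum_card_fiberwise (f := c) (t := J) (by intro w; simp; tauto)]
  refine Finset.sum_congr rfl fun i hi => ?_
  rw [nbrCount, Finset.filter_filter]
  congr 1
  ext w
  simp only [Finset.mem_filter]
  constructor
  · rintro ⟨h1, rfl, h3⟩
    exact ⟨h1, ⟨hi, h3⟩, rfl⟩
  · tauto

theorem one_le_nbrCount {y : V} (hy : y ∈ S) (hij : c y ≠ j) (h : ¬ Movable G S c (c y) j) :
    1 ≤ nbrCount G S c y j := by
  by_contra! hlt
  have h0 : nbrCount G S c y j = 0 := by omega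
  rw [nbrCount, Finset.card_eq_zero, Finset.filter_eq_empty_iff] at h0
  exact h ⟨hij, y, hy, rfl, fun w hw hwj hadj => h0 hw ⟨hwj, hadj⟩⟩

theorem exists_color_nbrCount_eq_zero {J : Finset ι} {v : V}
    (h : (S.filter fun w => G.Adj v w).card < J.card) :
    ∃ j ∈ J, ∀ w ∈ S, c w = j → ¬ G.Adj v w := by
  by_contra! hcon
  have : J.card ≤ ∑ i ∈ J, nbrCount G S c v i := by
    rw [Finset.card_eq_sum_ones]
    refine Finset.sum_le_sum fun i hi => ?_
    obtain ⟨w, hw, hwi, hvw⟩ := hcon i hi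
    exact Finset.card_pos.2 ⟨w, by simp [hw, hwi, hvw]⟩
  rw [sum_nbrCount] at this
  have h2 := Finset.card_le_card (s := S.filter fun w => c w ∈ J ∧ G.Adj v w)
    (t := S.filter fun w => G.Adj v w) (Finset.monotone_filter_right _ fun w _ hw => hw.2)
  omega

theorem weighted_double_count (w : V → ℕ) (X Y : Finset V) (m M : ℕ)
    (hY : ∀ y ∈ Y, m ≤ ∑ z ∈ X with G.Adj y z, w z)
    (hX : ∀ z ∈ X, w z * (Y.filter fun y => G.Adj z y).card ≤ M) :
    Y.card * m ≤ X.card * M := by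
  calc Y.card * m = ∑ _y ∈ Y, m := by simp
    _ ≤ ∑ y ∈ Y, ∑ z ∈ X with G.Adj y z, w z := Finset.sum_le_sum hY
    _ = ∑ z ∈ X, w z * (Y.filter fun y => G.Adj z y).card := by
      simp_rw [Finset.sum_filter]
      rw [Finset.sum_comm]
      refine Finset.sum_congr rfl fun z _ => ?_
      rw [← Finset.sum_filter, Finset.sum_const, smul_eq_mul, mul_comm]
      simp_rw [G.adj_comm z]
    _ ≤ ∑ _z ∈ X, M := Finset.sum_le_sum hX
    _ = X.card * M := by simp


theorem sum_nbrCount_add (A : Finset ι) (v : V) :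
    ∑ i ∈ A, nbrCount G S c v i + (S.filter fun w => c w ∉ A ∧ G.Adj v w).card =
      (S.filter fun w => G.Adj v w).card := by
  rw [sum_nbrCount, ← Finset.card_union_of_disjoint]
  · congr 1
    ext w
    simp only [Finset.mem_union, Finset.mem_filter]
    tauto
  · rw [Finset.disjoint_filter]
    tauto

theorem NearlyUniform.card_not_mem (h : NearlyUniform G S K s c a b) {A : Finset ι}
    (ha : a ∈ A) (hb : b ∉ A) (hbK : b ∈ K) :
    (S.filter (c · ∉ A)).card = s * (K \ A).card + 1 := by
  rw [Finset.card_eq_sum_card_fiberwise (f := c) (t := K \ A)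
    (by intro v; simp only [Finset.coe_filter, Finset.coe_sdiff]; intro hv
        exact ⟨h.mem v hv.1, hv.2⟩)]
  have : ∀ i ∈ K \ A, ((S.filter (c · ∉ A)).filter (c · = i)).card =
      s + (if i = b then 1 else 0) := by
    intro i hi
    rw [Finset.mem_sdiff] at hi
    have h1 := h.card_class i hi.1
    rw [if_neg (fun hia : i = a => hi.2 (hia ▸ ha)), add_zero] at h1
    rw [← h1, Finset.filter_filter]
    congr 1
    refine Finset.filter_congr fun v _ => ⟨fun hv => hv.2, fun hv => ⟨hv ▸ hi.2, hv⟩⟩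
  rw [Finset.sum_congr rfl this, Finset.sum_add_distrib, Finset.sum_ite_eq',
    if_pos (Finset.mem_sdiff.2 ⟨hbK, hb⟩)]
  simp [mul_comm]

/-- Recolor the vertices outside the classes in `A` by `d`, put `y` into class `W`, and then
move `z` to class `X`. -/
noncomputable def swapColoring (c d : V → ι) (A : Finset ι) (y z : V) (W X : ι) : V → ι :=
  Function.update (fun v => if v = y then W else if c v ∈ A then c v else d v) z X

theorem NearlyUniform.swap (h : NearlyUniform G S K s c a b) {A : Finset ι} (hAK : A ⊆ K)
    (ha : a ∈ A) (hb : b ∉ A) {y z : V} (hy : y ∈ S) (hyA : c y ∉ A) (hz : z ∈ S)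
    (hzA : c z ∈ A) (hyz : ∀ w ∈ S, c w = c z → G.Adj y w → w = z) {d : V → ι}
    (hd : Uniform G ((S.filter (c · ∉ A)).erase y) (K \ A) s d) {X : ι} (hXK : X ∈ K)
    (hXz : X ≠ c z)
    (hX : ∀ w ∈ S, w ≠ y → (if c w ∈ A then c w else d w) = X → ¬ G.Adj z w) :
    NearlyUniform G S K s (swapColoring c d A y z (c z) X) a X := by
  have hzy : z ≠ y := fun h => hyA (h ▸ hzA)
  have hdmem : ∀ v ∈ S, v ≠ y → c v ∉ A → d v ∈ K ∧ d v ∉ A := fun v hv hvy hvA =>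
    Finset.mem_sdiff.1 (hd.mem v (by simp [hv, hvy, hvA]))
  refine ⟨fun v hv => ?_, ?_, card_class_update (b := c z) ?_ hz (by simp [hzy, hzA])⟩
  · unfold swapColoring
    by_cases hvz : v = z
    · simpa [hvz] using hXK
    rw [Function.update_of_ne hvz]
    split_ifs with h1 h2
    · exact hAK hzA
    · exact hAK h2
    · exact (hdmem v hv h1 h2).1
  · have main : ∀ u ∈ S, ∀ v ∈ S, G.Adj u v → u ≠ y → u ≠ z → v ≠ z →
        swapColoring c d A y z (c z) X u ≠ swapColoring c d A y z (c z) X v := by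
      intro u hu v hv huv huy huz hvz
      simp only [swapColoring, Function.update_of_ne huz, Function.update_of_ne hvz, if_neg huy]
      by_cases hvy : v = y
      · subst hvy
        rw [if_pos rfl]
        split_ifs with h1
        · exact fun h2 => huz (hyz u hu h2 huv.symm)
        · exact fun h2 => (hdmem u hu huy h1).2 (h2 ▸ hzA)
      · rw [if_neg hvy]
        split_ifs with h1 h2 h2
        · exact h.proper u hu v hv huv
        · exact fun h3 => (hdmem v hv hvy h2).2 (h3 ▸ h1)
        · exact fun h3 => (hdmem u hu huy h1).2 (h3 ▸ h2)
        · exact hd.proper u (by simp [hu, huy, h1]) v (by simp [hv, hvy, h2]) huv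
    have mainz : ∀ v ∈ S, G.Adj z v →
        X ≠ swapColoring c d A y z (c z) X v := by
      intro v hv hzv
      rw [swapColoring, Function.update_of_ne hzv.ne']
      by_cases hvy : v = y
      · simpa [hvy] using hXz
      · rw [if_neg hvy]
        exact fun h1 => hX v hv hvy h1.symm hzv
    have selfz : swapColoring c d A y z (c z) X z = X := by simp [swapColoring]
    intro u hu v hv huv
    by_cases huz : u = z
    · subst huz
      rw [selfz]
      exact mainz v hv huv
    by_cases hvz : v = z
    · subst hvz
      rw [selfz]
      exact (mainz u hu huv.symm).symm
    by_cases huy : u = y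
    · subst huy
      exact (main v hv u hu huv.symm huv.ne' hvz huz).symm
    · exact main u hu v hv huv huy huz hvz
  · intro i hi
    by_cases hiA : i ∈ A
    · have h1 := h.card_class i hi
      rw [if_neg (fun hib : i = b => hb (hib ▸ hiA)), add_zero] at h1
      by_cases hiz : i = c z
      · have : S.filter (fun v => (if v = y then c z else if c v ∈ A then c v else d v) = i) =
            insert y (S.filter (c · = i)) := by
          ext v
          by_cases hvy : v = y
          · simp [hvy, hy, hiz]
          · by_cases hvA : c v ∈ A
            · simp [hvy, hvA]
            · simp only [Finset.mem_filter, Finset.mem_insert, hvy, hvA, if_false, false_or]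
              refine and_congr_right fun hv => ⟨fun h2 => ?_, fun h2 => ?_⟩
              · exact absurd hiA (h2 ▸ (hdmem v hv hvy hvA).2)
              · exact absurd hiA (h2 ▸ hvA)
        rw [this, Finset.card_insert_of_notMem
          (by simp only [Finset.mem_filter]; exact fun h2 => hyA (h2.2.symm ▸ hiA)), if_pos hiz]
        omega
      · have : S.filter (fun v => (if v = y then c z else if c v ∈ A then c v else d v) = i) =
            S.filter (c · = i) := by
          refine Finset.filter_congr fun v hv => ?_
          by_cases hvy : v = y
          · subst hvy
            rw [if_pos rfl]
            exact ⟨fun h2 => absurd h2.symm hiz, fun h2 => absurd hiA (h2 ▸ hyA)⟩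
          · by_cases hvA : c v ∈ A
            · simp [hvy, hvA]
            · simp only [hvy, hvA, if_false]
              refine ⟨fun h2 => ?_, fun h2 => ?_⟩
              · exact absurd hiA (h2 ▸ (hdmem v hv hvy hvA).2)
              · exact absurd hiA (h2 ▸ hvA)
        rw [this, if_neg hiz]
        omega
    · have : S.filter (fun v => (if v = y then c z else if c v ∈ A then c v else d v) = i) =
          ((S.filter (c · ∉ A)).erase y).filter (d · = i) := by
        ext v
        by_cases hvy : v = y
        · simp only [hvy, Finset.mem_filter, Finset.mem_erase]
          simp only [if_true, ne_eq, not_true, false_and, iff_false]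
          exact fun h2 => hiA (h2.2 ▸ hzA)
        · by_cases hvA : c v ∈ A
          · simp only [Finset.mem_filter, Finset.mem_erase, hvy, hvA]
            simp only [if_true, if_false, not_true, and_false, false_and, iff_false]
            exact fun h2 => hiA (h2.2 ▸ hvA)
          · simp [hvy, hvA]
      rw [this, hd.card_class i (Finset.mem_sdiff.2 ⟨hi, hiA⟩),
        if_neg (fun h2 : i = a => hiA (h2 ▸ ha)), if_neg (fun h2 : i = c z => hiA (h2 ▸ hzA))]

/-- If a vertex `z` of `A` is the only neighbor of `y` in its class, `c z` is terminal, and `z` can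
be moved within `A`, then the coloring can be made uniform. -/
theorem NearlyUniform.exists_uniform_of_movable (h : NearlyUniform G S K s c a b) {A : Finset ι}
    (hAK : A ⊆ K) (ha : a ∈ A) (hb : b ∉ A) {y z : V} (hy : y ∈ S) (hyA : c y ∉ A) (hz : z ∈ S)
    (hzA : c z ∈ A) (hyz : ∀ w ∈ S, c w = c z → G.Adj y w → w = z) {d : V → ι}
    (hd : Uniform G ((S.filter (c · ∉ A)).erase y) (K \ A) s d) {X : ι} (hXA : X ∈ A)
    (hXz : X ≠ c z) (hX : ∀ w ∈ S, c w = X → ¬ G.Adj z w)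
    (hreach : Reaches (Movable G S c) (fun j => j ∈ A ∧ j ≠ c z) a X) :
    ∃ c' : V → ι, Uniform G S K s c' := by
  have hdmem : ∀ v ∈ S, v ≠ y → c v ∉ A → d v ∉ A := fun v hv hvy hvA =>
    (Finset.mem_sdiff.1 (hd.mem v (by simp [hv, hvy, hvA]))).2
  have h' := h.swap hAK ha hb hy hyA hz hzA hyz hd (hAK hXA) hXz (by
    intro w hw hwy hwX
    split_ifs at hwX with h1
    · exact hX w hw hwX
    · exact absurd hXA (hwX ▸ hdmem w hw hwy h1))
  have hcls : ∀ k ∈ A, k ≠ c z → ∀ v ∈ S, c v = k → swapColoring c d A y z (c z) X v = k := by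
    intro k hk hkz v hv hvk
    have hvz : v ≠ z := fun h => hkz (h ▸ hvk.symm)
    have hvy : v ≠ y := fun h => hyA (h ▸ hvk ▸ hk)
    simp [swapColoring, hvz, hvy, hvk, hk]
  have hcls' : ∀ l ∈ A, l ≠ c z → l ≠ X → ∀ v ∈ S,
      swapColoring c d A y z (c z) X v = l → c v = l := by
    intro l hl hlz hlX v hv hvl
    unfold swapColoring at hvl
    by_cases hvz : v = z
    · subst hvz
      rw [Function.update_self] at hvl
      exact absurd hvl.symm hlX
    rw [Function.update_of_ne hvz] at hvl
    split_ifs at hvl with h1 h2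
    · exact absurd hvl.symm hlz
    · exact hvl
    · exact absurd hl (hvl ▸ hdmem v hv h1 h2)
  refine h'.exists_uniform_of_path ((A.erase (c z)).erase X)
    (((Finset.erase_subset _ _).trans (Finset.erase_subset _ _)).trans hAK) (by simp) ?_
  by_cases hXa : X = a
  · exact .inl hXa
  obtain ⟨l, hXl, hl⟩ := hreach.exists_exit hXa
  obtain ⟨⟨hlA, hlz⟩, hlX⟩ := hl.prop
  refine .inr ⟨l, hXl.congr (hcls X hXA hXz) (hcls' l hlA hlz hlX), hl.mono ?_ ?_⟩
  · rintro k m ⟨⟨hkA, hkz⟩, hkX⟩ ⟨⟨hmA, hmz⟩, hmX⟩ hkm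
    exact hkm.congr (hcls k hkA hkz) (hcls' m hmA hmz hmX)
  · rintro k ⟨⟨hkA, hkz⟩, hkX⟩
    simp [hkA, hkz, hkX]


/-- `z` is the only neighbor of `y` in the class of `z`. -/
def IsSolo (G : SimpleGraph V) (S : Finset V) (c : V → ι) (y z : V) : Prop :=
  G.Adj y z ∧ ∀ w ∈ S, c w = c z → G.Adj y w → w = z

theorem card_add_card_outside_lt (hdeg : ∀ v ∈ S, (S.filter fun w => G.Adj v w).card < K.card)
    {A J : Finset ι} (hJ : J ⊆ A) {v : V} (hv : v ∈ S) (h : ∀ i ∈ J, 1 ≤ nbrCount G S c v i) :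
    J.card + (S.filter fun w => c w ∉ A ∧ G.Adj v w).card < K.card := by
  have h1 := sum_nbrCount_add (G := G) (S := S) (c := c) A v
  have h2 : J.card ≤ ∑ i ∈ A, nbrCount G S c v i := by
    rw [Finset.card_eq_sum_ones]
    exact (Finset.sum_le_sum h).trans (Finset.sum_le_sum_of_subset hJ)
  have := hdeg v hv
  omega

theorem card_sdiff_lt_card_of_not_movable
    (hdeg : ∀ v ∈ S, (S.filter fun w => G.Adj v w).card < K.card)
    {A T : Finset ι} (hAK : A ⊆ K) (hTA : T ⊆ A) {u : ι}
    (hTu : ∀ x ∈ T, ∀ j ∈ A, Movable G S c x j → j = u ∨ j ∈ T)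
    (hB : (S.filter (c · ∉ A)).card = s * (K \ A).card + 1)
    (hBA : ∀ y ∈ S, c y ∉ A → ∀ i ∈ A, 1 ≤ nbrCount G S c y i)
    {W : ι} (hW : W ∈ T) (hWs : (S.filter (c · = W)).card = s)
    (hsolo : ∀ z ∈ S, c z = W → ∀ y ∈ S, c y ∉ A → IsSolo G S c y z →
      ∀ i ∈ A, i ≠ W → 1 ≤ nbrCount G S c z i) :
    (K \ A).card < T.card := by
  by_contra! hlt
  have hKA := Finset.card_sdiff_add_card_eq_card hAK
  have hcount := weighted_double_count (G := G)
    (fun z => if ∃ y ∈ S, c y ∉ A ∧ IsSolo G S c y z then 2 else 1)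
    (S.filter (c · = W)) (S.filter (c · ∉ A)) 2 (2 * (K \ A).card) ?_ ?_
  · rw [hB, hWs] at hcount
    nlinarith
  · intro y hy
    rw [Finset.mem_filter] at hy
    have h1 := hBA y hy.1 hy.2 W (hTA hW)
    rw [Finset.filter_filter]
    rcases h1.eq_or_lt with h1 | h1
    · obtain ⟨z, hz⟩ := Finset.card_eq_one.1 h1.symm
      have hmem : ∀ w, w ∈ S ∧ c w = W ∧ G.Adj y w ↔ w = z := fun w => by
        simpa using Finset.ext_iff.1 hz w
      have hz' := (hmem z).2 rfl
      rw [hz, Finset.sum_singleton, if_pos]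
      exact ⟨y, hy.1, hy.2, hz'.2.2, fun w hw hwz hyw => (hmem w).1 ⟨hw, hwz.trans hz'.2.1, hyw⟩⟩
    · calc 2 ≤ nbrCount G S c y W := h1
        _ = ∑ z ∈ S with c z = W ∧ G.Adj y z, 1 := by rw [nbrCount, Finset.card_eq_sum_ones]
        _ ≤ _ := Finset.sum_le_sum fun z _ => by split_ifs <;> omega
  · intro z hz
    rw [Finset.mem_filter] at hz
    rw [Finset.filter_filter]
    split_ifs with h1
    · obtain ⟨y, hy, hyA, hyz⟩ := h1
      have h2 := card_add_card_outside_lt hdeg (Finset.erase_subset W A) hz.1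
        (fun i hi => hsolo z hz.1 hz.2 y hy hyA hyz i (Finset.mem_of_mem_erase hi)
          (Finset.ne_of_mem_erase hi))
      rw [Finset.card_erase_of_mem (hTA hW)] at h2
      omega
    · have h2 := card_add_card_outside_lt (c := c) hdeg (J := A \ insert u T) Finset.sdiff_subset hz.1
        (fun i hi => by
          rw [Finset.mem_sdiff, Finset.mem_insert] at hi
          refine one_le_nbrCount hz.1 ?_ ?_
          · rintro h3
            exact hi.2 (.inr (h3 ▸ hz.2.symm ▸ hW))
          · rw [hz.2]
            exact fun h3 => hi.2 (hTu W hW i hi.1 h3))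
      have h3 := Finset.le_card_sdiff (insert u T) A
      have h4 := Finset.card_insert_le u T
      omega

theorem card_add_le_card_solo
    (hdeg : ∀ v ∈ S, (S.filter fun w => G.Adj v w).card < K.card)
    {A T : Finset ι} (hAK : A ⊆ K) (hTA : T ⊆ A) {y : V} (hy : y ∈ S)
    (hBA : ∀ i ∈ A, 1 ≤ nbrCount G S c y i) :
    T.card + 1 + (S.filter fun w => c w ∉ A ∧ G.Adj y w).card ≤
      (S.filter fun z => c z ∈ T ∧ IsSolo G S c y z).card + (K \ A).card := by
  have hKA := Finset.card_sdiff_add_card_eq_card hAK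
  have h1 := sum_nbrCount_add (G := G) (S := S) (c := c) A y
  have h2 := hdeg y hy
  have h3 : (S.filter fun z => c z ∈ T ∧ IsSolo G S c y z).card =
      ∑ i ∈ T, (S.filter fun z => c z = i ∧ IsSolo G S c y z).card := by
    rw [Finset.card_eq_sum_card_fiberwise (f := c) (t := T) (by intro w; simp; tauto)]
    refine Finset.sum_congr rfl fun i hi => ?_
    rw [Finset.filter_filter]
    congr 1
    refine Finset.filter_congr fun w _ => ⟨fun h => ⟨h.2, h.1.2⟩, fun h => ⟨⟨?_, h.2⟩, h.1⟩⟩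
    exact h.1 ▸ hi
  have h4 : ∑ _i ∈ T, 2 ≤ ∑ i ∈ T, ((S.filter fun z => c z = i ∧ IsSolo G S c y z).card +
      nbrCount G S c y i) := by
    refine Finset.sum_le_sum fun i hi => ?_
    rcases (hBA i (hTA hi)).eq_or_lt with h5 | h5
    · obtain ⟨z, hz⟩ := Finset.card_eq_one.1 h5.symm
      have hmem : ∀ w, w ∈ S ∧ c w = i ∧ G.Adj y w ↔ w = z := fun w => by
        simpa using Finset.ext_iff.1 hz w
      have hz' := (hmem z).2 rfl
      have : 0 < (S.filter fun z => c z = i ∧ IsSolo G S c y z).card :=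
        Finset.card_pos.2 ⟨z, Finset.mem_filter.2 ⟨hz'.1, hz'.2.1, hz'.2.2,
          fun w hw hwz hyw => (hmem w).1 ⟨hw, hwz.trans hz'.2.1, hyw⟩⟩⟩
      omega
    · omega
  rw [Finset.sum_add_distrib, Finset.sum_const, smul_eq_mul] at h4
  have h5 : (A \ T).card ≤ ∑ i ∈ A \ T, nbrCount G S c y i := by
    rw [Finset.card_eq_sum_ones]
    exact Finset.sum_le_sum fun i hi => hBA i (Finset.mem_sdiff.1 hi).1
  have h6 := Finset.sum_sdiff (f := nbrCount G S c y) hTA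
  have h7 := Finset.card_sdiff_add_card_eq_card hTA
  omega

theorem exists_maximal_independent (G : SimpleGraph V) (B : Finset V) :
    ∃ I ⊆ B, (∀ x ∈ I, ∀ y ∈ I, ¬ G.Adj x y) ∧ ∀ v ∈ B, v ∈ I ∨ ∃ y ∈ I, G.Adj y v := by
  obtain ⟨I, hI, hmax⟩ := Finset.exists_max_image
    (B.powerset.filter fun I => ∀ x ∈ I, ∀ y ∈ I, ¬ G.Adj x y) Finset.card ⟨∅, by simp⟩
  simp only [Finset.mem_filter, Finset.mem_powerset] at hI hmax
  refine ⟨I, hI.1, hI.2, fun v hv => ?_⟩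
  by_contra! hcon
  have h1 := hmax (insert v I) ⟨Finset.insert_subset hv hI.1, ?_⟩
  · rw [Finset.card_insert_of_notMem hcon.1] at h1
    omega
  · intro x hx y hy
    rw [Finset.mem_insert] at hx hy
    rcases hx with rfl | hx <;> rcases hy with rfl | hy
    · exact G.irrefl
    · exact fun h => hcon.2 y hy h.symm
    · exact hcon.2 x hx
    · exact hI.2 x hx y hy

theorem exists_nonadj_solo
    (hdeg : ∀ v ∈ S, (S.filter fun w => G.Adj v w).card < K.card)
    {A T : Finset ι} (hAK : A ⊆ K) (hTA : T ⊆ A) (hTs : ∀ i ∈ T, (S.filter (c · = i)).card = s)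
    (hB : (S.filter (c · ∉ A)).card = s * (K \ A).card + 1)
    (hBA : ∀ y ∈ S, c y ∉ A → ∀ i ∈ A, 1 ≤ nbrCount G S c y i)
    (hlt : (K \ A).card < T.card) :
    ∃ z ∈ S, c z ∈ T ∧ ∃ y₁ ∈ S, c y₁ ∉ A ∧ ∃ y₂ ∈ S, c y₂ ∉ A ∧ y₁ ≠ y₂ ∧ ¬ G.Adj y₁ y₂ ∧
      IsSolo G S c y₁ z ∧ IsSolo G S c y₂ z := by
  obtain ⟨I, hIB, hI, hmax⟩ := exists_maximal_independent G (S.filter (c · ∉ A))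
  have hmemI : ∀ y ∈ I, y ∈ S ∧ c y ∉ A := fun y hy => Finset.mem_filter.1 (hIB hy)
  by_contra! hcon
  have hA' : (S.filter (c · ∈ T)).card = T.card * s := by
    rw [Finset.card_eq_sum_card_fiberwise (f := c) (t := T) (by intro w; simp), ← smul_eq_mul,
      ← Finset.sum_const]
    refine Finset.sum_congr rfl fun i hi => ?_
    rw [← hTs i hi, Finset.filter_filter]
    congr 1
    exact Finset.filter_congr fun w _ => ⟨fun h => h.2, fun h => ⟨h ▸ hi, h⟩⟩
  have hsolo : ∑ y ∈ I, (S.filter fun z => c z ∈ T ∧ IsSolo G S c y z).card ≤ T.card * s := by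
    have h1 := Finset.sum_card_bipartiteAbove_eq_sum_card_bipartiteBelow (s := I)
      (t := S.filter (c · ∈ T)) (IsSolo G S c)
    simp only [Finset.bipartiteAbove, Finset.bipartiteBelow, Finset.filter_filter] at h1
    rw [h1, ← hA', Finset.card_eq_sum_ones]
    refine Finset.sum_le_sum fun z hz => Finset.card_le_one.2 fun y₁ hy₁ y₂ hy₂ => ?_
    rw [Finset.mem_filter] at hz hy₁ hy₂
    by_contra hne
    exact hcon z hz.1 hz.2 y₁ (hmemI _ hy₁.1).1 (hmemI _ hy₁.1).2 y₂ (hmemI _ hy₂.1).1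
      (hmemI _ hy₂.1).2 hne (hI _ hy₁.1 _ hy₂.1) hy₁.2 hy₂.2
  have hlow : ∑ y ∈ I, (T.card + 1 + (S.filter fun w => c w ∉ A ∧ G.Adj y w).card) ≤
      ∑ y ∈ I, ((S.filter fun z => c z ∈ T ∧ IsSolo G S c y z).card + (K \ A).card) :=
    Finset.sum_le_sum fun y hy => card_add_le_card_solo hdeg hAK hTA (hmemI y hy).1
      (hBA y (hmemI y hy).1 (hmemI y hy).2)
  have hcover : s * (K \ A).card + 1 ≤
      ∑ y ∈ I, (1 + (S.filter fun w => c w ∉ A ∧ G.Adj y w).card) := by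
    rw [← hB]
    refine (Finset.card_le_card (t := I.biUnion fun y =>
      insert y (S.filter fun w => c w ∉ A ∧ G.Adj y w)) fun v hv => ?_).trans
      (Finset.card_biUnion_le.trans (Finset.sum_le_sum fun y _ => ?_))
    · rw [Finset.mem_biUnion]
      rcases hmax v hv with h | ⟨y, hy, hyv⟩
      · exact ⟨v, h, Finset.mem_insert_self _ _⟩
      · rw [Finset.mem_filter] at hv
        exact ⟨y, hy, by simp [hv, hyv]⟩
    · rw [add_comm]
      exact Finset.card_insert_le _ _
  have hup : ∑ y ∈ I, (1 + (S.filter fun w => c w ∉ A ∧ G.Adj y w).card) ≤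
      ∑ _y ∈ I, (K \ A).card := by
    refine Finset.sum_le_sum fun y hy => ?_
    have h1 := card_add_card_outside_lt hdeg subset_rfl (hmemI y hy).1
      (hBA y (hmemI y hy).1 (hmemI y hy).2)
    have hKA := Finset.card_sdiff_add_card_eq_card hAK
    omega
  simp only [Finset.sum_add_distrib, Finset.sum_const, smul_eq_mul, mul_one] at *
  have hIs : s < I.card := by
    by_contra! h
    have := Nat.mul_le_mul_right (K \ A).card h
    omega
  obtain ⟨e, he⟩ := Nat.exists_eq_add_of_lt hlt
  rw [he] at hlow hsolo
  nlinarith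


/-- The colors whose classes can reach the small class `a`. -/
noncomputable def accessible (G : SimpleGraph V) (S : Finset V) (K : Finset ι) (c : V → ι)
    (a : ι) : Finset ι :=
  K.filter (Reaches (Movable G S c) (· ∈ K) a)

theorem accessible_subset : accessible G S K c a ⊆ K := Finset.filter_subset _ _

theorem reaches_of_mem_accessible (h : i ∈ accessible G S K c a) :
    Reaches (Movable G S c) (· ∈ accessible G S K c a) a i :=
  (Finset.mem_filter.1 h).2.strengthen.mono (fun _ _ _ _ h => h)
    fun _ hj => Finset.mem_filter.2 ⟨hj.prop, hj⟩

theorem mem_accessible_of_movable (hi : i ∈ K) (hj : j ∈ accessible G S K c a)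
    (h : Movable G S c i j) : i ∈ accessible G S K c a :=
  Finset.mem_filter.2 ⟨hi, .step hi h (Finset.mem_filter.1 hj).2⟩

theorem NearlyUniform.exists_ne_mem_accessible (h : NearlyUniform G S K s c a b)
    (hdeg : ∀ v ∈ S, (S.filter fun w => G.Adj v w).card < K.card) {A : Finset ι}
    (ha : a ∈ A) (hb : b ∉ A) (hAK : A ⊆ K) (hbK : b ∈ K)
    (hBA : ∀ y ∈ S, c y ∉ A → ∀ i ∈ A, 1 ≤ nbrCount G S c y i) : ∃ i ∈ A, i ≠ a := by
  by_contra! hcon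
  have hA : A = {a} := Finset.eq_singleton_iff_unique_mem.2 ⟨ha, hcon⟩
  have hB := h.card_not_mem ha hb hbK
  have hq : (K \ A).card = K.card - 1 := by
    rw [Finset.card_sdiff_of_subset hAK, hA, Finset.card_singleton]
  have hcls := h.card_class a (hAK ha)
  rw [if_pos rfl, if_neg (fun hab : a = b => hb (hab ▸ ha))] at hcls
  have hcount := weighted_double_count (G := G) (fun _ => 1) (S.filter (c · = a))
    (S.filter (c · ∉ A)) 1 (K.card - 1) ?_ ?_
  · rw [hB, hq] at hcount
    have := Nat.mul_le_mul_right (K.card - 1) (show (S.filter (c · = a)).card ≤ s by omega)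
    omega
  · intro y hy
    rw [Finset.mem_filter] at hy
    rw [← Finset.card_eq_sum_ones, Finset.filter_filter]
    exact hBA y hy.1 hy.2 a ha
  · intro z hz
    rw [Finset.mem_filter] at hz
    rw [one_mul, Finset.filter_filter]
    have h1 := hdeg z hz.1
    have h2 := Finset.card_le_card (s := S.filter fun w => c w ∉ A ∧ G.Adj z w)
      (t := S.filter fun w => G.Adj z w) (Finset.monotone_filter_right _ fun w _ hw => hw.2)
    omega

/-- Swapping a solo vertex `z` with one of two nonadjacent vertices `y₁`, `y₂` for which it is the
only neighbor in its class makes more classes accessible. -/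
theorem card_sdiff_accessible_swap_lt {A : Finset ι} (hA : A = accessible G S K c a) {y₁ y₂ z : V}
    (hy₁A : c y₁ ∉ A) (hy₂ : y₂ ∈ S) (hy₂A : c y₂ ∉ A) (hne : y₁ ≠ y₂)
    (hnadj : ¬ G.Adj y₁ y₂) (hzA : c z ∈ A) (hza : c z ≠ a)
    (hy₂z : ∀ w ∈ S, c w = c z → G.Adj y₂ w → w = z) {d : V → ι}
    (hd : Uniform G ((S.filter (c · ∉ A)).erase y₁) (K \ A) s d) {X : ι} (hX : X ∈ K \ A)
    (hreach : ∀ i ∈ A, i ≠ c z → Reaches (Movable G S c) (fun j => j ∈ A ∧ j ≠ c z) a i)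
    (hz : ∀ i ∈ A, i ≠ c z → 1 ≤ nbrCount G S c z i) :
    (K \ accessible G S K (swapColoring c d A y₁ z (c z) X) a).card < (K \ A).card := by
  have hAK : A ⊆ K := hA ▸ accessible_subset
  have hdmem : ∀ v ∈ S, v ≠ y₁ → c v ∉ A → d v ∈ K ∧ d v ∉ A := fun v hv hvy hvA =>
    Finset.mem_sdiff.1 (hd.mem v (by simp [hv, hvy, hvA]))
  rw [Finset.mem_sdiff] at hX
  have hstay : ∀ v, v ≠ z → c v ∈ A → swapColoring c d A y₁ z (c z) X v = c v := by
    intro v hvz hvA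
    have hvy : v ≠ y₁ := fun h => hy₁A (h ▸ hvA)
    simp [swapColoring, hvz, hvy, hvA]
  have hback : ∀ v ∈ S, swapColoring c d A y₁ z (c z) X v ∈ A →
      v ≠ z ∧ (v = y₁ ∨ c v = swapColoring c d A y₁ z (c z) X v) := by
    intro v hv hvA
    unfold swapColoring at hvA ⊢
    by_cases hvz : v = z
    · subst hvz
      rw [Function.update_self] at hvA
      exact absurd hvA hX.2
    rw [Function.update_of_ne hvz] at hvA ⊢
    refine ⟨hvz, ?_⟩
    split_ifs at hvA ⊢ with h1 h2
    · exact .inl h1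
    · exact .inr rfl
    · exact absurd hvA (hdmem v hv h1 h2).2
  have hy₁c : swapColoring c d A y₁ z (c z) X y₁ = c z := by
    have : y₁ ≠ z := fun h => hy₁A (h ▸ hzA)
    simp [swapColoring, this]
  have hcls' : ∀ l ∈ A, l ≠ c z → ∀ v ∈ S,
      swapColoring c d A y₁ z (c z) X v = l → c v = l := by
    rintro l hl hlz v hv rfl
    refine (hback v hv hl).2.resolve_left ?_
    rintro rfl
    exact hlz hy₁c
  have hsub : A ⊆ accessible G S K (swapColoring c d A y₁ z (c z) X) a := by
    have h1 : ∀ i ∈ A, i ≠ c z → i ∈ accessible G S K (swapColoring c d A y₁ z (c z) X) a := by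
      intro i hi hiz
      refine Finset.mem_filter.2 ⟨hAK hi, (hreach i hi hiz).mono ?_ fun j hj => hAK hj.1⟩
      intro k l hk hl hkl
      refine hkl.congr (fun v _ hvk => ?_) (hcls' l hl.1 hl.2)
      rw [hstay v (fun h => hk.2 (h ▸ hvk.symm)) (hvk ▸ hk.1), hvk]
    intro i hi
    by_cases hiz : i = c z
    · subst hiz
      have h2 := hi
      rw [hA] at h2
      obtain ⟨j, ⟨hzj, y, hy, hyz, hyj⟩, hj⟩ := (reaches_of_mem_accessible h2).exists_exit hza
      have hjA : j ∈ A := hA ▸ hj.prop.1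
      have hyz' : y ≠ z := by
        rintro rfl
        obtain ⟨w, hw⟩ := Finset.card_pos.1 (hz j hjA hj.prop.2)
        rw [Finset.mem_filter] at hw
        exact hyj w hw.1 hw.2.1 hw.2.2
      refine mem_accessible_of_movable (hAK hi) (h1 j hjA hj.prop.2)
        ⟨hzj, y, hy, (hstay y hyz' (hyz ▸ hi)).trans hyz, fun w hw hwj => ?_⟩
      exact hyj w hw (hcls' j hjA hj.prop.2 w hw hwj)
    · exact h1 i hi hiz
  have hy₂c : swapColoring c d A y₁ z (c z) X y₂ = d y₂ := by
    have : y₂ ≠ z := fun h => hy₂A (h ▸ hzA)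
    simp [swapColoring, this, hne.symm, hy₂A]
  obtain ⟨hdK, hdA⟩ := hdmem y₂ hy₂ hne.symm hy₂A
  have hnew : d y₂ ∈ accessible G S K (swapColoring c d A y₁ z (c z) X) a := by
    refine mem_accessible_of_movable hdK (hsub hzA)
      ⟨fun h => hdA (h ▸ hzA), y₂, hy₂, hy₂c, fun w hw hwz hadj => ?_⟩
    obtain ⟨h1, h2 | h2⟩ := hback w hw (hwz.symm ▸ hzA)
    · exact hnadj (h2 ▸ hadj.symm)
    · exact h1 (hy₂z w hw (h2.trans hwz) hadj)
  refine Finset.card_lt_card ((Finset.ssubset_iff_of_subset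
    (Finset.sdiff_subset_sdiff subset_rfl hsub)).2 ⟨d y₂, ?_, ?_⟩)
  · exact Finset.mem_sdiff.2 ⟨hdK, hdA⟩
  · exact fun h => (Finset.mem_sdiff.1 h).2 hnew

theorem NearlyUniform.exists_uniform
    (hdeg : ∀ v ∈ S, (S.filter fun w => G.Adj v w).card < K.card)
    (hind : ∀ S' ⊂ S, ∀ K' : Finset ι,
      (∀ v ∈ S', (S'.filter fun w => G.Adj v w).card < K'.card) → S'.card = s * K'.card →
      ∃ d : V → ι, Uniform G S' K' s d) (ha : a ∈ K) (n : ℕ) :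
    ∀ {c : V → ι} {b : ι}, b ∈ K → NearlyUniform G S K s c a b →
      (K \ accessible G S K c a).card < n → ∃ c' : V → ι, Uniform G S K s c' := by
  induction n with
  | zero => intro c b _ _ h; exact absurd h (Nat.not_lt_zero _)
  | succ n ih =>
    intro c b hbK h hn
    obtain ⟨A, hA⟩ : ∃ A, A = accessible G S K c a := ⟨_, rfl⟩
    rw [← hA] at hn
    have hAK : A ⊆ K := hA ▸ accessible_subset
    have haA : a ∈ A := hA ▸ Finset.mem_filter.2 ⟨ha, .base ha⟩
    by_cases hb : b ∈ A
    · refine h.exists_uniform_of_path (K.erase b) (Finset.erase_subset _ _)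
        (Finset.notMem_erase _ _) ?_
      by_cases hba : b = a
      · exact .inl hba
      rw [hA] at hb
      obtain ⟨j, hj, hj'⟩ := (reaches_of_mem_accessible hb).exists_exit hba
      exact .inr ⟨j, hj, hj'.mono (fun _ _ _ _ h => h) fun k hk =>
        Finset.mem_erase.2 ⟨hk.2, accessible_subset hk.1⟩⟩
    have hBA : ∀ y ∈ S, c y ∉ A → ∀ i ∈ A, 1 ≤ nbrCount G S c y i := fun y hy hyA i hi =>
      one_le_nbrCount hy (fun hyi => hyA (hyi ▸ hi))
        fun hm => hyA (hA ▸ mem_accessible_of_movable (h.mem y hy) (hA ▸ hi) hm)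
    have hB := h.card_not_mem haA hb hbK
    have hKA := Finset.card_sdiff_add_card_eq_card hAK
    have hrest : ∀ y ∈ S, c y ∉ A →
        ∃ d : V → ι, Uniform G ((S.filter (c · ∉ A)).erase y) (K \ A) s d := by
      intro y hy hyA
      have hyB : y ∈ S.filter (c · ∉ A) := Finset.mem_filter.2 ⟨hy, hyA⟩
      refine hind _ ((Finset.erase_ssubset hyB).trans_subset (Finset.filter_subset _ _)) _ ?_ ?_
      · intro v hv
        have hv' := Finset.mem_filter.1 (Finset.mem_of_mem_erase hv)
        have h1 := card_add_card_outside_lt hdeg subset_rfl hv'.1 (hBA v hv'.1 hv'.2)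
        have h2 := Finset.card_le_card
          (s := ((S.filter (c · ∉ A)).erase y).filter fun w => G.Adj v w)
          (t := S.filter fun w => c w ∉ A ∧ G.Adj v w) (fun w => by
            simp only [Finset.mem_filter, Finset.mem_erase]; tauto)
        omega
      · rw [Finset.card_erase_of_mem hyB, hB, Nat.add_sub_cancel]
    obtain ⟨u, -, T, hTA, ⟨W, hW⟩, haT, -, hterm, hTu⟩ := exists_terminal_set A
      (fun i hi => hA ▸ reaches_of_mem_accessible (hA ▸ hi)) haA
      (h.exists_ne_mem_accessible hdeg haA hb hAK hbK hBA)
    have hTs : ∀ i ∈ T, (S.filter (c · = i)).card = s := fun i hi => by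
      have h1 := h.card_class i (hAK (hTA hi))
      rwa [if_neg (fun hia : i = a => haT (hia ▸ hi)),
        if_neg (fun hib : i = b => hb (hib ▸ hTA hi))] at h1
    by_cases hsolo : ∀ z ∈ S, c z ∈ T → ∀ y ∈ S, c y ∉ A → IsSolo G S c y z →
        ∀ i ∈ A, i ≠ c z → 1 ≤ nbrCount G S c z i
    · have hlt := card_sdiff_lt_card_of_not_movable hdeg hAK hTA hTu hB hBA hW (hTs W hW)
        (fun z hz hzW y hy hyA hyz i hi hiW =>
          hsolo z hz (hzW ▸ hW) y hy hyA hyz i hi (hzW ▸ hiW))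
      obtain ⟨z, hz, hzT, y₁, hy₁, hy₁A, y₂, hy₂, hy₂A, hne, hnadj, hyz₁, hyz₂⟩ :=
        exists_nonadj_solo hdeg hAK hTA hTs hB hBA hlt
      have hzA := hTA hzT
      have hzi := hsolo z hz hzT y₁ hy₁ hy₁A hyz₁
      obtain ⟨d, hd⟩ := hrest y₁ hy₁ hy₁A
      obtain ⟨X, hXK, hX⟩ := exists_color_nbrCount_eq_zero (G := G) (c := d) (v := z)
        (S := (S.filter (c · ∉ A)).erase y₁) (J := K \ A) (by
          have h1 := card_add_card_outside_lt hdeg (Finset.erase_subset (c z) A) hz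
            (fun i hi => hzi i (Finset.mem_of_mem_erase hi) (Finset.ne_of_mem_erase hi))
          rw [Finset.card_erase_of_mem hzA] at h1
          have h2 := Finset.card_lt_card
            (s := ((S.filter (c · ∉ A)).erase y₁).filter fun w => G.Adj z w)
            (t := S.filter fun w => c w ∉ A ∧ G.Adj z w)
            ((Finset.ssubset_iff_of_subset (fun w => by
              simp only [Finset.mem_filter, Finset.mem_erase]; tauto)).2
              ⟨y₁, by simp [hy₁, hy₁A, hyz₁.1.symm], by simp⟩)
          have h3 := Finset.card_pos.2 ⟨_, hzA⟩
          omega)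
      have hXK' := Finset.mem_sdiff.1 hXK
      refine ih hXK'.1 (h.swap hAK haA hb hy₁ hy₁A hz hzA hyz₁.2 hd hXK'.1
        (fun hXz => hXK'.2 (hXz ▸ hzA)) ?_) ((card_sdiff_accessible_swap_lt hA hy₁A hy₂ hy₂A hne
          hnadj hzA (fun hza => haT (hza ▸ hzT)) hyz₂.2 hd hXK (hterm _ hzT) hzi).trans_le
          (Nat.le_of_lt_succ hn))
      intro w hw hwy hwX
      split_ifs at hwX with hwA
      · exact absurd (hwX ▸ hwA) hXK'.2
      · exact hX w (by simp [hw, hwy, hwA]) hwX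
    · push Not at hsolo
      obtain ⟨z, hz, hzT, y, hy, hyA, hyz, X, hXA, hXz, hX⟩ := hsolo
      obtain ⟨d, hd⟩ := hrest y hy hyA
      refine h.exists_uniform_of_movable hAK haA hb hy hyA hz (hTA hzT) hyz.2 hd hXA hXz ?_
        (hterm _ hzT X hXA hXz)
      intro w hw hwX hzw
      have : 0 < nbrCount G S c z X := Finset.card_pos.2 ⟨w, by simp [hw, hwX, hzw]⟩
      omega

theorem exists_uniform_bot [Nonempty ι] (hS : S.card = s * K.card) :
    ∃ c : V → ι, Uniform (⊥ : SimpleGraph V) S K s c := by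
  have e : S ≃ K × Fin s := Fintype.equivOfCardEq (by simp [hS, mul_comm])
  refine ⟨fun v => if h : v ∈ S then (e ⟨v, h⟩).1 else Classical.arbitrary ι,
    fun v hv => by simp [hv], fun _ _ _ _ h => h.elim, fun i hi => ?_⟩
  refine Eq.trans (Eq.symm ?_) (Finset.card_fin s)
  refine Finset.card_bij (fun t _ => (e.symm (⟨i, hi⟩, t) : V)) ?_ ?_ ?_
  · intro t _
    simp
  · intro t _ t' _ h
    simpa using h
  · intro v hv
    rw [Finset.mem_filter] at hv
    have hv2 := hv.2
    rw [dif_pos hv.1] at hv2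
    refine ⟨(e ⟨v, hv.1⟩).2, Finset.mem_univ _, ?_⟩
    have : ((⟨i, hi⟩, (e ⟨v, hv.1⟩).2) : K × Fin s) = e ⟨v, hv.1⟩ :=
      Prod.ext (Subtype.ext hv2.symm) rfl
    rw [this, Equiv.symm_apply_apply]

/-- The **Hajnal–Szemerédi theorem** for vertex sets whose size is a multiple of the number of
colors. -/
theorem exists_uniform [Nonempty ι] (s : ℕ) (S : Finset V) :
    ∀ (G : SimpleGraph V) (K : Finset ι),
      (∀ v ∈ S, (S.filter fun w => G.Adj v w).card < K.card) → S.card = s * K.card →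
      ∃ c : V → ι, Uniform G S K s c := by
  induction S using Finset.strongInduction with
  | H S ihS =>
    intro G K hdeg hS
    obtain ⟨H, hH⟩ : ∃ H : Finset V → SimpleGraph V,
        ∀ T u v, (H T).Adj u v ↔ G.Adj u v ∧ u ∈ T ∧ v ∈ T :=
      ⟨fun T =>
        { Adj := fun u v => G.Adj u v ∧ u ∈ T ∧ v ∈ T
          symm := ⟨fun u v h => ⟨h.1.symm, h.2.2, h.2.1⟩⟩
          loopless := ⟨fun u h => G.irrefl h.1⟩ }, fun _ _ _ => Iff.rfl⟩
    have key : ∀ T : Finset V, ∃ c : V → ι, Uniform (H T) S K s c := by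
      intro T
      induction T using Finset.induction_on with
      | empty =>
        obtain ⟨c, hc⟩ := exists_uniform_bot (K := K) hS
        exact ⟨c, hc.mem, fun u _ v _ h => by simp [hH] at h, hc.card_class⟩
      | insert x T _ ihT =>
        obtain ⟨c, hc⟩ := ihT
        have hdeg' : ∀ v ∈ S, (S.filter fun w => (H (insert x T)).Adj v w).card < K.card :=
          fun v hv => (Finset.card_le_card
            (Finset.monotone_filter_right _ fun w _ hw => ((hH _ _ _).1 hw).1)).trans_lt (hdeg v hv)
        have hadj : ∀ u v, (H (insert x T)).Adj u v → u ≠ x → v ≠ x → (H T).Adj u v :=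
          fun u v h hu hv => (hH _ _ _).2 ⟨((hH _ _ _).1 h).1,
            Finset.mem_of_mem_insert_of_ne ((hH _ _ _).1 h).2.1 hu,
            Finset.mem_of_mem_insert_of_ne ((hH _ _ _).1 h).2.2 hv⟩
        by_cases hx : x ∈ S
        · obtain ⟨j, hj, hxj⟩ := exists_color_nbrCount_eq_zero (G := H (insert x T)) (c := c)
            (hdeg' x hx)
          refine NearlyUniform.exists_uniform (a := c x) (b := j) (c := Function.update c x j)
            hdeg' (fun S' hS' K' => ihS S' hS' _ K') (hc.mem x hx) _ hj
            ⟨fun v hv => ?_, fun u hu v hv huv => ?_, card_class_update (b := c x)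
              (fun i hi => by rw [hc.card_class i hi]) hx rfl⟩
            (Nat.lt_succ_self _)
          · by_cases hvx : v = x
            · simpa [hvx] using hj
            · simpa [hvx] using hc.mem v hv
          · by_cases hux : u = x
            · subst hux
              rw [Function.update_self, Function.update_of_ne huv.ne']
              exact fun hcv => hxj v hv hcv.symm huv
            · by_cases hvx : v = x
              · subst hvx
                rw [Function.update_self, Function.update_of_ne hux]
                exact fun hcu => hxj u hu hcu huv.symm
              · rw [Function.update_of_ne hux, Function.update_of_ne hvx]
                exact hc.proper u hu v hv (hadj u v huv hux hvx)
        · refine ⟨c, hc.mem, fun u hu v hv huv => hc.proper u hu v hv (hadj u v huv ?_ ?_),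
            hc.card_class⟩
          · rintro rfl
            exact hx hu
          · rintro rfl
            exact hx hv
    obtain ⟨c, hc⟩ := key S
    exact ⟨c, hc.mem, fun u hu v hv huv => hc.proper u hu v hv ((hH _ _ _).2 ⟨huv, hu, hv⟩),
      hc.card_class⟩

end Coloring

end EquitableColoring

theorem stmt_6 {V : Type} [Fintype V] [DecidableEq V]
    (G : SimpleGraph V) [DecidableRel G.Adj]
    (k : ℕ) (hk : G.maxDegree < k) :
    ∃ c : V → Fin k,
      (∀ u v, G.Adj u v → c u ≠ c v) ∧
      ∀ i j : Fin k,
        (Finset.univ.filter fun v => c v = i).card ≤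
          (Finset.univ.filter fun v => c v = j).card + 1 := by
  classical
  have hk0 : 0 < k := by omega
  have : Nonempty (Fin k) := ⟨⟨0, hk0⟩⟩
  obtain ⟨p, s, hpk, hps⟩ : ∃ p s, p ≤ k ∧ Fintype.card V + p = s * k := by
    refine ⟨k - Fintype.card V % k, Fintype.card V / k + 1, Nat.sub_le _ _, ?_⟩
    have h1 := Nat.div_add_mod (Fintype.card V) k
    have h2 := Nat.mod_lt (Fintype.card V) hk0
    rw [add_mul, one_mul, mul_comm]
    omega
  obtain ⟨c, hc⟩ := EquitableColoring.exists_uniform (ι := Fin k) s Finset.univ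
    (G ⊕g (⊤ : SimpleGraph (Fin p))) Finset.univ (by
      rintro (v | v) -
      · have h1 : Finset.univ.filter (fun w => (G ⊕g (⊤ : SimpleGraph (Fin p))).Adj (.inl v) w) =
            (G.neighborFinset v).map .inl := by
          ext (w | w) <;> simp
        rw [h1, Finset.card_map, Finset.card_fin]
        exact (G.degree_le_maxDegree v).trans_lt hk
      · have h1 : Finset.univ.filter (fun w => (G ⊕g (⊤ : SimpleGraph (Fin p))).Adj (.inr v) w) =
            (Finset.univ.erase v).map .inr := by
          ext (w | w) <;> simp [eq_comm]
        have := v.pos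
        rw [h1, Finset.card_map, Finset.card_erase_of_mem (Finset.mem_univ _), Finset.card_fin,
          Finset.card_fin]
        omega) (by simpa using hps)
  refine ⟨fun v => c (.inl v), fun u v huv => hc.proper _ (Finset.mem_univ _) _
    (Finset.mem_univ _) (by simpa using huv), fun i j => ?_⟩
  have hsplit : ∀ i, (Finset.univ.filter fun v => c (.inl v) = i).card +
      (Finset.univ.filter fun v => c (.inr v) = i).card = s := by
    intro i
    rw [← hc.card_class i (Finset.mem_univ _), ← Finset.card_disjSum]
    congr 1
    ext (w | w) <;> simp
  have hone : ∀ i, (Finset.univ.filter fun v => c (.inr v) = i).card ≤ 1 := by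
    intro i
    refine Finset.card_le_one.2 fun x hx y hy => ?_
    rw [Finset.mem_filter] at hx hy
    by_contra hxy
    exact hc.proper (.inr x) (Finset.mem_univ _) (.inr y) (Finset.mem_univ _) (by simpa using hxy)
      (hx.2.trans hy.2.symm)
  beta_reduce
  have := hsplit i
  have := hsplit j
  have := hone j
  omega
end

section
/- Let H be a (finite simple) graph and let V_1, ..., V_n be pairwise disjoint subsets of V(H). If for every subset S of {1, ..., n} the total domination number of H_S is at least 2|S| − 1, then (V_1, ..., V_n) has an independent set of representatives in H. -/
open SimpleGraph

/-- `f` picks pairwise non-adjacent representatives of the classes `Vs k`, `k ∈ I`. -/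
def IsIndepTransversal {V ι : Type*} (G : SimpleGraph V) (I : Finset ι) (Vs : ι → Finset V)
    (f : ι → V) : Prop :=
  (∀ k ∈ I, f k ∈ Vs k) ∧ ∀ k ∈ I, ∀ l ∈ I, k ≠ l → ¬ G.Adj (f k) (f l)

/-- If the classes other than `Vs i` have an independent transversal but all classes together do
not, then some subfamily containing `Vs i` is totally dominated by at most `2 (|S| - 1)` of its
own vertices. -/
theorem exists_small_totally_dominating {V ι : Type*} [Finite V] [DecidableEq V] [DecidableEq ι]
    (G : SimpleGraph V) (I : Finset ι) (Vs : ι → Finset V) (i : ι) (hi : i ∈ I)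
    (hdisj : ∀ k l, k ≠ l → Disjoint (Vs k) (Vs l))
    (hnone : ¬ ∃ f, IsIndepTransversal G I Vs f)
    (hsome : ∃ f, IsIndepTransversal G (I.erase i) Vs f) :
    ∃ S ⊆ I, i ∈ S ∧ ∃ X ⊆ S.biUnion Vs, X.card + 2 ≤ 2 * S.card ∧
      ∀ u ∈ S.biUnion Vs, ∃ x ∈ X, G.Adj u x := by
  classical
  induction hN : I.card + G.edgeSet.ncard using Nat.strong_induction_on generalizing G I Vs with
  | _ N ih =>
  subst hN
  have hclass : ∀ {k l v}, v ∈ Vs k → v ∈ Vs l → k = l := by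
    intro k l v hk hl
    by_contra hkl
    exact Finset.disjoint_left.1 (hdisj k l hkl) hk hl
  rcases (Vs i).eq_empty_or_nonempty with hemp | ⟨x, hx⟩
  · exact ⟨{i}, by simpa using hi, by simp, ∅, by simp, by simp, by simp [hemp]⟩
  obtain ⟨y, j, hj, hji, hy, hxy⟩ : ∃ y, ∃ j ∈ I, j ≠ i ∧ y ∈ Vs j ∧ G.Adj x y := by
    by_contra! hcon
    obtain ⟨f, hf, hind⟩ := hsome
    simp only [Finset.mem_erase] at hf hind
    refine hnone ⟨Function.update f i x, fun k hk => ?_, fun k hk l hl hkl => ?_⟩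
    · by_cases h : k = i
      · subst h; simpa using hx
      · simpa [h] using hf k ⟨h, hk⟩
    · by_cases h : k = i
      · subst h
        simpa [hkl.symm] using hcon _ l hl hkl.symm (hf l ⟨hkl.symm, hl⟩)
      · by_cases h' : l = i
        · subst h'
          simpa [h, G.adj_comm] using hcon _ k hk h (hf k ⟨h, hk⟩)
        · simpa [h, h'] using hind k ⟨h, hk⟩ l ⟨h', hl⟩ hkl
  by_cases hdel : ∃ f, IsIndepTransversal (G.deleteEdges {s(x, y)}) I Vs f
  swap
  · have hlt : (G.deleteEdges {s(x, y)}).edgeSet.ncard < G.edgeSet.ncard := by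
      apply Set.ncard_lt_ncard _ (Set.toFinite _)
      rw [edgeSet_deleteEdges, Set.sdiff_singleton_ssubset]
      exact hxy
    obtain ⟨S, hSI, hiS, X, hX, hcard, hdom⟩ := ih _ (Nat.add_lt_add_left hlt _)
      (G.deleteEdges {s(x, y)}) I Vs hi hdisj hdel
      (hsome.imp fun f hf => ⟨hf.1, fun k hk l hl hkl h =>
        hf.2 k hk l hl hkl (deleteEdges_le _ h)⟩) rfl
    refine ⟨S, hSI, hiS, X, hX, hcard, fun u hu => ?_⟩
    obtain ⟨z, hz, h⟩ := hdom u hu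
    exact ⟨z, hz, deleteEdges_le _ h⟩
  obtain ⟨f, hf, hind⟩ := hdel
  -- The only conflict in `f` is the deleted edge, so `f` uses both of its ends.
  obtain ⟨hfi, hfj⟩ : f i = x ∧ f j = y := by
    by_contra hcon
    refine hnone ⟨f, hf, fun k hk l hl hkl h => hind k hk l hl hkl ?_⟩
    rw [deleteEdges_adj]
    refine ⟨h, fun he => hcon ?_⟩
    rw [Set.mem_singleton_iff, Sym2.eq_iff] at he
    rcases he with ⟨h1, h2⟩ | ⟨h1, h2⟩
    · have hki : k = i := hclass (hf k hk) (h1 ▸ hx)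
      have hlj : l = j := hclass (hf l hl) (h2 ▸ hy)
      exact ⟨hki ▸ h1, hlj ▸ h2⟩
    · have hkj : k = j := hclass (hf k hk) (h1 ▸ hy)
      have hli : l = i := hclass (hf l hl) (h2 ▸ hx)
      exact ⟨hli ▸ h2, hkj ▸ h1⟩
  -- Merge the classes `i` and `j`, and discard all neighbours of `x` and `y`.
  let W : ι → Finset V := fun k =>
    (if k = i then Vs i ∪ Vs j else if k = j then ∅ else Vs k).filter
      fun v => ¬ G.Adj v x ∧ ¬ G.Adj v y
  have hW : ∀ {k v}, v ∈ W k ↔ (k = i ∧ (v ∈ Vs i ∨ v ∈ Vs j) ∨ k ≠ i ∧ k ≠ j ∧ v ∈ Vs k) ∧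
      ¬ G.Adj v x ∧ ¬ G.Adj v y := by
    intro k v
    simp only [W, Finset.mem_filter]
    split_ifs with h1 h2 <;> simp [*]
  have hWdisj : ∀ k l, k ≠ l → Disjoint (W k) (W l) := by
    intro k l hkl
    rw [Finset.disjoint_left]
    intro v hk hl
    obtain ⟨hk, -⟩ := hW.1 hk
    obtain ⟨hl, -⟩ := hW.1 hl
    rcases hk with ⟨h1, h2 | h2⟩ | ⟨h1, h2, h3⟩ <;> rcases hl with ⟨h4, h5 | h5⟩ | ⟨h4, h5, h6⟩ <;>
      grind
  have hWnone : ¬ ∃ g, IsIndepTransversal G (I.erase j) W g := by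
    rintro ⟨g, hg, hgind⟩
    simp only [Finset.mem_erase] at hg hgind
    have hmem : ∀ k ∈ I, k ≠ j → k ≠ i → g k ∈ Vs k := by
      intro k hk h1 h2
      have := (hW.1 (hg k ⟨h1, hk⟩)).1
      grind
    have hnx : ∀ k ∈ I, k ≠ j → ¬ G.Adj (g k) x := fun k hk h => (hW.1 (hg k ⟨h, hk⟩)).2.1
    have hny : ∀ k ∈ I, k ≠ j → ¬ G.Adj (g k) y := fun k hk h => (hW.1 (hg k ⟨h, hk⟩)).2.2
    have hgi := (hW.1 (hg i ⟨hji.symm, hi⟩)).1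
    have hgi' : g i ∈ Vs i ∨ g i ∈ Vs j := by grind
    rcases hgi' with h | h
    · refine hnone ⟨Function.update g j y, fun k hk => ?_, fun k hk l hl hkl => ?_⟩
      · by_cases hkj : k = j
        · subst hkj; simpa using hy
        · by_cases hki : k = i
          · subst hki; simpa [hkj] using h
          · simpa [hkj] using hmem k hk hkj hki
      · simp only [Function.update_apply]
        split_ifs with h1 h2 h2
        · simp
        · rw [G.adj_comm]; exact hny l hl h2
        · exact hny k hk h1
        · exact hgind k ⟨h1, hk⟩ l ⟨h2, hl⟩ hkl
    · refine hnone ⟨Function.update (Function.update g j (g i)) i x, fun k hk => ?_,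
        fun k hk l hl hkl => ?_⟩
      · by_cases hki : k = i
        · subst hki; simpa using hx
        · by_cases hkj : k = j
          · subst hkj; simpa [hki] using h
          · simpa [hki, hkj] using hmem k hk hkj hki
      · have key : ∀ a ∈ I, ¬ G.Adj (Function.update g j (g i) a) x := by
          intro a ha
          by_cases haj : a = j
          · subst haj; simpa using hnx i hi hji.symm
          · simpa [haj] using hnx a ha haj
        by_cases hki : k = i
        · subst hki
          have := key l hl
          rw [G.adj_comm] at this
          simpa [hkl.symm] using this
        · by_cases hli : l = i
          · subst hli
            simpa [hki] using key k hk
          · simp only [Function.update_apply, hki, hli, if_false]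
            split_ifs with h1 h2 h2
            · simp
            · exact hgind i ⟨hji.symm, hi⟩ l ⟨h2, hl⟩ (Ne.symm hli)
            · exact hgind k ⟨h1, hk⟩ i ⟨hji.symm, hi⟩ hki
            · exact hgind k ⟨h1, hk⟩ l ⟨h2, hl⟩ hkl
  have hWsome : IsIndepTransversal G ((I.erase j).erase i) W f := by
    have hne : ∀ k ∈ I, k ≠ i → k ≠ j → f k ≠ x ∧ f k ≠ y := fun k hk h1 h2 =>
      ⟨fun h => h1 (hclass (hf k hk) (h ▸ hx)), fun h => h2 (hclass (hf k hk) (h ▸ hy))⟩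
    have hG : ∀ k ∈ I, k ≠ i → k ≠ j → ∀ l ∈ I, k ≠ l → ¬ G.Adj (f k) (f l) := by
      intro k hk h1 h2 l hl hkl h
      refine hind k hk l hl hkl ?_
      have := hne k hk h1 h2
      rw [deleteEdges_adj, Set.mem_singleton_iff, Sym2.eq_iff]
      exact ⟨h, by tauto⟩
    simp only [IsIndepTransversal, Finset.mem_erase]
    refine ⟨fun k ⟨h1, h2, hk⟩ => hW.2 ⟨Or.inr ⟨h1, h2, hf k hk⟩, ?_, ?_⟩,
      fun k ⟨h1, h2, hk⟩ l ⟨_, _, hl⟩ hkl => hG k hk h1 h2 l hl hkl⟩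
    · exact hfi ▸ hG k hk h1 h2 i hi h1
    · exact hfj ▸ hG k hk h1 h2 j hj h2
  obtain ⟨S, hSI, hiS, X, hX, hcard, hdom⟩ := ih _
    (Nat.add_lt_add_right (Finset.card_erase_lt_of_mem hj) _) G (I.erase j) W
    (Finset.mem_erase.2 ⟨hji.symm, hi⟩) hWdisj hWnone ⟨f, hWsome⟩ rfl
  have hjS : j ∉ S := fun h => (Finset.mem_erase.1 (hSI h)).1 rfl
  refine ⟨insert j S, ?_, Finset.mem_insert_of_mem hiS, insert x (insert y X), ?_, ?_, ?_⟩
  · exact Finset.insert_subset hj (hSI.trans (Finset.erase_subset _ _))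
  · intro v hv
    simp only [Finset.mem_biUnion, Finset.mem_insert] at hv ⊢
    rcases hv with rfl | rfl | hv
    · exact ⟨i, Or.inr hiS, hx⟩
    · exact ⟨j, Or.inl rfl, hy⟩
    · obtain ⟨k, hk, hvk⟩ := Finset.mem_biUnion.1 (hX hv)
      rcases (hW.1 hvk).1 with ⟨-, h | h⟩ | ⟨-, -, h⟩
      · exact ⟨i, Or.inr hiS, h⟩
      · exact ⟨j, Or.inl rfl, h⟩
      · exact ⟨k, Or.inr hk, h⟩
  · have h1 := Finset.card_insert_le x (insert y X)
    have h2 := Finset.card_insert_le y X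
    rw [Finset.card_insert_of_notMem hjS]
    omega
  · intro u hu
    by_cases hux : G.Adj u x
    · exact ⟨x, by simp, hux⟩
    by_cases huy : G.Adj u y
    · exact ⟨y, by simp, huy⟩
    have huW : u ∈ S.biUnion W := by
      simp only [Finset.mem_biUnion, Finset.mem_insert] at hu ⊢
      obtain ⟨k, hk, hu⟩ := hu
      by_cases hki : k = i
      · subst hki
        exact ⟨k, hiS, hW.2 ⟨Or.inl ⟨rfl, Or.inl hu⟩, hux, huy⟩⟩
      by_cases hkj : k = j
      · subst hkj
        exact ⟨i, hiS, hW.2 ⟨Or.inl ⟨rfl, Or.inr hu⟩, hux, huy⟩⟩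
      · exact ⟨k, hk.resolve_left hkj, hW.2 ⟨Or.inr ⟨hki, hkj, hu⟩, hux, huy⟩⟩
    obtain ⟨z, hz, h⟩ := hdom u huW
    exact ⟨z, by simp [hz], h⟩

theorem stmt_7 {V : Type} [Fintype V] [DecidableEq V]
    (H : SimpleGraph V)
    {n : ℕ} (Vs : Fin n → Finset V)
    (hdisj : ∀ i j, i ≠ j → Disjoint (Vs i) (Vs j))
    -- for every `S ⊆ [n]`, every total dominating set `X` of `H_S` satisfies
    -- `|X| ≥ 2|S| - 1` (if `H_S` has an isolated vertex there is no such `X`,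
    -- corresponding to infinite total domination number)
    (htd : ∀ S : Finset (Fin n), ∀ X : Finset V,
      X ⊆ S.biUnion Vs →
      (∀ u ∈ S.biUnion Vs, ∃ x ∈ X,
        H.Adj u x ∧ ¬ ∃ i ∈ S, u ∈ Vs i ∧ x ∈ Vs i) →
      2 * S.card - 1 ≤ X.card) :
    ∃ R : Finset V,
      (∀ u ∈ R, ∀ v ∈ R, ¬ H.Adj u v) ∧
      (∀ i, (R ∩ Vs i).card = 1) ∧
      R ⊆ Finset.univ.biUnion Vs := by
  have hclass : ∀ {k l v}, v ∈ Vs k → v ∈ Vs l → k = l := by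
    intro k l v hk hl
    by_contra hkl
    exact Finset.disjoint_left.1 (hdisj k l hkl) hk hl
  rcases isEmpty_or_nonempty V with hV | ⟨⟨v₀⟩⟩
  · refine ⟨∅, by simp, fun i => ?_, by simp⟩
    have := htd {i} ∅ (by simp) (fun u => (hV.false u).elim)
    simp at this
  let G : SimpleGraph V :=
    { Adj := fun u v => H.Adj u v ∧ ¬ ∃ i, u ∈ Vs i ∧ v ∈ Vs i
      symm := ⟨fun u v h => ⟨h.1.symm, fun ⟨i, hu, hv⟩ => h.2 ⟨i, hv, hu⟩⟩⟩
      loopless := ⟨fun u h => H.irrefl h.1⟩ }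
  have hall : ∀ I : Finset (Fin n), ∃ f, IsIndepTransversal G I Vs f := by
    intro I
    induction I using Finset.induction_on with
    | empty => exact ⟨fun _ => v₀, by simp, by simp⟩
    | insert i I hiI hI =>
      by_contra hnone
      obtain ⟨S, -, -, X, hX, hcard, hdom⟩ := exists_small_totally_dominating G (insert i I) Vs i
        (Finset.mem_insert_self i I) hdisj hnone (by rwa [Finset.erase_insert hiI])
      have := htd S X hX fun u hu => by
        obtain ⟨x, hx, h⟩ := hdom u hu
        exact ⟨x, hx, h.1, fun ⟨k, _, hk⟩ => h.2 ⟨k, hk⟩⟩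
      omega
  obtain ⟨f, hf, hind⟩ := hall Finset.univ
  simp only [Finset.mem_univ, true_imp_iff] at hf hind
  refine ⟨Finset.univ.image f, ?_, fun i => Finset.card_eq_one.2 ⟨f i, ?_⟩, ?_⟩
  · simp only [Finset.mem_image, Finset.mem_univ, true_and]
    rintro _ ⟨k, rfl⟩ _ ⟨l, rfl⟩ h
    by_cases hkl : k = l
    · subst hkl
      exact H.irrefl h
    · exact hind k l hkl ⟨h, fun ⟨i, hk, hl⟩ =>
        hkl ((hclass (hf k) hk).trans (hclass (hf l) hl).symm)⟩
  · ext v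
    simp only [Finset.mem_inter, Finset.mem_image, Finset.mem_univ, true_and,
      Finset.mem_singleton]
    constructor
    · rintro ⟨⟨k, rfl⟩, hk⟩
      rw [hclass (hf k) hk]
    · rintro rfl
      exact ⟨⟨i, rfl⟩, hf i⟩
  · intro v hv
    obtain ⟨k, -, rfl⟩ := Finset.mem_image.1 hv
    exact Finset.mem_biUnion.2 ⟨k, Finset.mem_univ k, hf k⟩
end

section
/- Let H be a (finite simple) graph with maximum degree at most 2, and let G be obtained from H by gluing in vertex-disjoint copies of K_4. Let T be the set of triangles in H. Then there is a set of vertices Z with |Z| ≤ |T|/4, containing at most one vertex from each cycle of H, such that the chromatic number of G − Z is at most 4; moreover |V(G) \ Z| ≥ (11/12)|V(G)|. -/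
open SimpleGraph

/-- `G` is obtained from `H` by gluing in vertex-disjoint copies of `K₄`. -/
def GluedK4 {V : Type} [DecidableEq V] (H G : SimpleGraph V) : Prop :=
  ∃ (q : ℕ) (Y : Fin q → Finset V),
    (∀ j, (Y j).card = 4) ∧
    (∀ i j, i ≠ j → Disjoint (Y i) (Y j)) ∧
    ∀ u v, G.Adj u v ↔ H.Adj u v ∨ (u ≠ v ∧ ∃ j, u ∈ Y j ∧ v ∈ Y j)

/-- `s` is the vertex set of a cycle subgraph of `H`. -/
def IsCycleSet {V : Type} [DecidableEq V] (H : SimpleGraph V) (s : Finset V) : Prop :=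
  ∃ (v : V) (w : H.Walk v v), w.IsCycle ∧ w.support.toFinset = s

/-- Averaging a sum over `ZMod 2` along one coordinate taking three values. -/
theorem sum_eq_zero_of_sum_update_eq_zero {ι : Type*} [Fintype ι] [DecidableEq ι]
    (g : (ι → Fin 3) → ZMod 2) (t : ι)
    (h : ∀ z, ∑ i, g (Function.update z t i) = 0) : ∑ z, g z = 0 := by
  have hinv : Function.Involutive
      (fun p : (ι → Fin 3) × Fin 3 => (Function.update p.1 t p.2, p.1 t)) := by
    rintro ⟨z, i⟩
    simp
  have h1 : ∑ p : (ι → Fin 3) × Fin 3, g (Function.update p.1 t p.2) =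
      ∑ p : (ι → Fin 3) × Fin 3, g p.1 :=
    Equiv.sum_comp hinv.toPerm (fun p => g p.1)
  rw [Fintype.sum_prod_type, Fintype.sum_prod_type] at h1
  simp only [h, Finset.sum_const_zero, Finset.sum_const, Finset.card_univ, Fintype.card_fin] at h1
  rw [← Finset.smul_sum] at h1
  have h3 : ∀ x : ZMod 2, 0 = 3 • x → x = 0 := by decide
  exact h3 _ h1

theorem sum_prod_comp_eq_zero {ι : Type*} [Fintype ι] [DecidableEq ι]
    (w : ι → Fin 3 → ι → Fin 3 → ZMod 2)
    (hsum : ∀ t s j, s ≠ t → ∑ i, w t i s j = 0)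
    (φ : ι → ι) (hφ : ¬ Function.Surjective φ) :
    ∑ z : ι → Fin 3, ∏ t, w t (z t) (φ t) (z (φ t)) = 0 := by
  obtain ⟨t, ht⟩ := not_forall.1 hφ
  push Not at ht
  refine sum_eq_zero_of_sum_update_eq_zero _ t fun z => ?_
  have key : ∀ i, ∏ r, w r (Function.update z t i r) (φ r) (Function.update z t i (φ r)) =
      w t i (φ t) (z (φ t)) * ∏ r ∈ Finset.univ.erase t, w r (z r) (φ r) (z (φ r)) := by
    intro i
    rw [← Finset.mul_prod_erase _ _ (Finset.mem_univ t)]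
    congr 1
    · simp [Function.update_of_ne (ht t)]
    · refine Finset.prod_congr rfl fun r hr => ?_
      rw [Function.update_of_ne (Finset.ne_of_mem_erase hr), Function.update_of_ne (ht r)]
  simp only [key, ← Finset.sum_mul, hsum t _ _ (ht t), zero_mul]

theorem sum_prod_involution_eq_zero {ι : Type*} [Fintype ι] [DecidableEq ι]
    (w : ι → Fin 3 → ι → Fin 3 → ZMod 2)
    (hsymm : ∀ t i s j, s ≠ t → w t i s j = w s j t i)
    (hsum : ∀ t s j, s ≠ t → ∑ i, w t i s j = 0)
    (φ : ι → ι) (hφ : Function.Involutive φ) {t : ι} (ht : φ t ≠ t) :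
    ∑ z : ι → Fin 3, ∏ t, w t (z t) (φ t) (z (φ t)) = 0 := by
  refine sum_eq_zero_of_sum_update_eq_zero _ t fun z => ?_
  have hsq : ∀ x : ZMod 2, x * x = x := by decide
  have key : ∀ i, ∏ r, w r (Function.update z t i r) (φ r) (Function.update z t i (φ r)) =
      w t i (φ t) (z (φ t)) *
        ∏ r ∈ (Finset.univ.erase t).erase (φ t), w r (z r) (φ r) (z (φ r)) := by
    intro i
    rw [← Finset.mul_prod_erase _ _ (Finset.mem_univ t),
      ← Finset.mul_prod_erase _ _ (Finset.mem_erase.2 ⟨ht, Finset.mem_univ _⟩), ← mul_assoc]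
    congr 1
    · simp only [hφ t, Function.update_self, Function.update_of_ne ht]
      rw [hsymm (φ t) _ t _ ht.symm, hsq]
    · refine Finset.prod_congr rfl fun r hr => ?_
      obtain ⟨h1, h2⟩ : r ≠ φ t ∧ r ≠ t := by simpa using hr
      have h3 : φ r ≠ t := fun h => h1 (by rw [← h, hφ r])
      rw [Function.update_of_ne h2, Function.update_of_ne h3]
  simp only [key, ← Finset.sum_mul, hsum t _ _ ht, zero_mul]

theorem sum_prod_sum_eq_one {ι : Type*} [Fintype ι] [DecidableEq ι]
    (w : ι → Fin 3 → ι → Fin 3 → ZMod 2)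
    (hdiag : ∀ t i, w t i t i = 1)
    (hsymm : ∀ t i s j, s ≠ t → w t i s j = w s j t i)
    (hsum : ∀ t s j, s ≠ t → ∑ i, w t i s j = 0) :
    ∑ z : ι → Fin 3, ∏ t, ∑ s, w t (z t) s (z s) = 1 := by
  simp only [Finset.prod_univ_sum, Fintype.piFinset_univ]
  rw [Finset.sum_comm]
  set F : (ι → ι) → ZMod 2 := fun φ => ∑ z : ι → Fin 3, ∏ t, w t (z t) (φ t) (z (φ t)) with hF
  have hinj : Function.Injective (fun σ : Equiv.Perm ι => (σ : ι → ι)) :=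
    DFunLike.coe_injective
  have hperm : ∑ φ, F φ = ∑ σ : Equiv.Perm ι, F σ := by
    symm
    refine Finset.sum_of_injOn (fun σ : Equiv.Perm ι => (σ : ι → ι)) hinj.injOn
      (fun _ _ => by simp) (fun φ _ hφ => ?_) (fun _ _ => rfl)
    refine sum_prod_comp_eq_zero w hsum φ fun hs => hφ ?_
    exact ⟨Equiv.ofBijective φ (Finite.injective_iff_bijective.1
      (Finite.injective_iff_surjective.2 hs)), by simp, rfl⟩
  have hinvF : ∀ σ : Equiv.Perm ι, F (σ⁻¹ : Equiv.Perm ι) = F σ := by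
    intro σ
    refine Finset.sum_congr rfl fun z _ => ?_
    rw [← Equiv.prod_comp σ]
    refine Finset.prod_congr rfl fun t _ => ?_
    rw [show σ⁻¹ (σ t) = t from σ.symm_apply_apply t]
    by_cases h : σ t = t
    · simp [h]
    · exact hsymm _ _ _ _ (Ne.symm h)
  have hid : F (1 : Equiv.Perm ι) = 1 := by
    simp only [hF, Equiv.Perm.coe_one, id, hdiag, Finset.prod_const_one, Finset.sum_const,
      Finset.card_univ, Fintype.card_fun, Fintype.card_fin, nsmul_eq_mul, mul_one]
    push_cast
    rw [show (3 : ZMod 2) = 1 from rfl, one_pow]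
  change ∑ φ, F φ = 1
  rw [hperm, ← Finset.add_sum_erase _ _ (Finset.mem_univ 1), hid]
  suffices ∑ σ ∈ Finset.univ.erase (1 : Equiv.Perm ι), F σ = 0 by rw [this, add_zero]
  refine Finset.sum_involution (fun σ _ => σ⁻¹) (fun σ _ => ?_) (fun σ hσ hne h => hne ?_)
    (fun σ hσ => by simpa using hσ) (fun σ _ => inv_inv σ)
  · rw [hinvF]
    exact CharTwo.add_self_eq_zero _
  · obtain ⟨t, ht⟩ : ∃ t, σ t ≠ t := by
      by_contra! hall
      exact Finset.ne_of_mem_erase hσ (Equiv.ext hall)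
    exact sum_prod_involution_eq_zero w hsymm hsum σ
      (fun x => (congrArg (fun τ : Equiv.Perm ι => τ (σ x)) h).symm.trans (σ.symm_apply_apply x)) ht

/-- The local factor at a vertex of colour `c`: `h` and `h + d` record the orientations of the two
incident edges. -/
def vertexWeight (h d : ZMod 2) (c : Fin 3) : ZMod 2 :=
  (if h = 0 then ![0, 1, 1] c else ![1, 0, 1] c) *
    (if h + d = 0 then ![1, 0, 1] c else ![0, 1, 1] c)

theorem sum_perm_prod_vertexWeight (h d : Fin 3 → ZMod 2) :
    ∑ σ : Equiv.Perm (Fin 3), ∏ i, vertexWeight (h i) (d i) (σ i) =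
      ∑ z : Fin 3, if d = fun i => if i = z then 0 else 1 then h (z + 1) + h (z + 2) else 0 := by
  revert h d
  decide +kernel

/-- The partial sum of `δ` over the vertices preceding `a` in the order given by `k`. -/
def prefixSum {W : Type*} [Fintype W] (k : W → ℤ) (δ : W → ZMod 2) (a : W) : ZMod 2 :=
  ∑ b, if k b < k a then δ b else 0

theorem sum_prod_vertexWeight_eq_zero {W : Type*} [Fintype W] [DecidableEq W] (k : W → ℤ)
    (hk : Function.Injective k) (x : W → Fin 3) {a b : W} (hab : k b = k a + 1)
    (hx : x a = x b) :
    ∑ δ : W → ZMod 2, ∏ c, vertexWeight (prefixSum k δ c) (δ c) (x c) = 0 := by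
  have hne : b ≠ a := by rintro rfl; omega
  set e : W → ZMod 2 := Pi.single a 1 + Pi.single b 1 with he
  have hea : e a = 1 := by simp [he, hne.symm]
  have heb : e b = 1 := by simp [he, hne]
  have hec : ∀ c, c ≠ a → c ≠ b → e c = 0 := fun c h1 h2 => by simp [he, h1, h2]
  have hadd : ∀ δ c, prefixSum k (δ + e) c = prefixSum k δ c + prefixSum k e c := by
    intro δ c
    simp only [prefixSum, ← Finset.sum_add_distrib]
    exact Finset.sum_congr rfl fun d _ => by split_ifs <;> simp
  have hpe : ∀ c, prefixSum k e c = (if k a < k c then 1 else 0) + if k b < k c then 1 else 0 := by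
    intro c
    have : ∀ d, (if k d < k c then e d else 0) =
        (if d = a then (if k a < k c then 1 else 0) else 0) +
          if d = b then (if k b < k c then 1 else 0) else 0 := by
      intro d
      by_cases h1 : d = a
      · subst h1; simp [hne.symm, hea]
      · by_cases h2 : d = b
        · subst h2; simp [h1, heb]
        · simp [h1, h2, hec d h1 h2]
    simp only [prefixSum, this, Finset.sum_add_distrib, Finset.sum_ite_eq', Finset.mem_univ,
      if_true]
  have hpa : prefixSum k e a = 0 := by rw [hpe, if_neg (by omega), if_neg (by omega), add_zero]
  have hpb : prefixSum k e b = 1 := by rw [hpe, if_pos (by omega), if_neg (by omega), add_zero]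
  have hpc : ∀ c, c ≠ a → c ≠ b → prefixSum k e c = 0 := by
    intro c h1 h2
    have h3 : k c ≠ k b := fun h => h2 (hk h)
    rw [hpe]
    by_cases h : k a < k c
    · rw [if_pos h, if_pos (by omega)]; rfl
    · rw [if_neg h, if_neg (by omega), add_zero]
  have hpab : ∀ δ, prefixSum k δ b = prefixSum k δ a + δ a := by
    intro δ
    have : δ a = ∑ d, if d = a then δ d else 0 := by simp
    rw [this, prefixSum, prefixSum, ← Finset.sum_add_distrib]
    refine Finset.sum_congr rfl fun d _ => ?_
    by_cases h : d = a
    · subst h; simp [hab]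
    · have h3 : k d ≠ k a := fun h' => h (hk h')
      by_cases h4 : k d < k a
      · rw [if_pos h4, if_pos (by omega), if_neg h, add_zero]
      · rw [if_neg h4, if_neg (by omega), if_neg h, add_zero]
  have hee : ∀ y : ZMod 2, y + y = 0 := by decide
  refine Finset.sum_involution (fun δ _ => δ + e) (fun δ _ => ?_) (fun δ _ _ h => ?_)
    (fun _ _ => Finset.mem_univ _) (fun δ _ => ?_)
  · have hba : b ∈ Finset.univ.erase a := by simp [hne]
    have hprod : ∀ g : W → ZMod 2,
        ∏ c, g c = g a * g b * ∏ c ∈ (Finset.univ.erase a).erase b, g c := fun g => by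
      rw [mul_assoc, Finset.mul_prod_erase _ _ hba, Finset.mul_prod_erase _ _ (Finset.mem_univ a)]
    rw [hprod, hprod]
    have hrest : ∏ c ∈ (Finset.univ.erase a).erase b,
          vertexWeight (prefixSum k (δ + e) c) ((δ + e) c) (x c) =
        ∏ c ∈ (Finset.univ.erase a).erase b, vertexWeight (prefixSum k δ c) (δ c) (x c) := by
      refine Finset.prod_congr rfl fun c hc => ?_
      obtain ⟨h1, h2⟩ : c ≠ b ∧ c ≠ a := by simpa using hc
      rw [hadd, hpc c h2 h1, Pi.add_apply, hec c h2 h1, add_zero, add_zero]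
    rw [hrest, ← add_mul, hadd, hadd, hpa, hpb, hpab, Pi.add_apply, Pi.add_apply, hea, heb, hx]
    convert zero_mul _
    generalize prefixSum k δ a = p
    generalize δ a = q
    generalize δ b = r
    generalize x b = y
    revert p q r y
    decide +kernel
  · have := congrFun h a
    rw [Pi.add_apply, hea] at this
    simp at this
  · ext c
    simp only [Pi.add_apply, add_assoc, hee, add_zero]

/-- The parity of the number of crossings between the chords obtained from the triples `t` and `s`
by leaving out `i` and `j`; it is normalised to `1` when `t = s` and `i = j`. -/
def crossing {ι : Type*} (k : ι × Fin 3 → ℤ) (t : ι) (i : Fin 3) (s : ι) (j : Fin 3) : ZMod 2 :=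
  ∑ m : Fin 3, ((if k (s, m) < k (t, i + 1) then if m = j then 0 else 1 else 0) +
    if k (s, m) < k (t, i + 2) then if m = j then 0 else 1 else 0)

theorem crossing_self {ι : Type*} {k : ι × Fin 3 → ℤ} (hk : Function.Injective k) (t : ι)
    (i : Fin 3) : crossing k t i t i = 1 := by
  have h : ∀ i j : Fin 3, i ≠ j → k (t, i) ≠ k (t, j) := fun i j hij h =>
    hij (Prod.ext_iff.1 (hk h)).2
  have h01 := h 0 1 (by decide)
  have h02 := h 0 2 (by decide)
  have h12 := h 1 2 (by decide)
  have e1 : (1 : Fin 3) + 1 = 2 := rfl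
  have e2 : (1 : Fin 3) + 2 = 0 := rfl
  have e3 : (2 : Fin 3) + 1 = 0 := rfl
  have e4 : (2 : Fin 3) + 2 = 1 := rfl
  fin_cases i <;> simp [crossing, Fin.sum_univ_three, e1, e2, e3, e4] <;> grind

theorem crossing_comm {ι : Type*} {k : ι × Fin 3 → ℤ} (hk : Function.Injective k) (t : ι)
    (i : Fin 3) (s : ι) (j : Fin 3) (hst : s ≠ t) : crossing k t i s j = crossing k s j t i := by
  have h : ∀ i j : Fin 3, (if k (s, j) < k (t, i) then (1 : ZMod 2) else 0) =
      1 + if k (t, i) < k (s, j) then 1 else 0 := fun i j => by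
    have : k (s, j) ≠ k (t, i) := fun h => hst (Prod.ext_iff.1 (hk h)).1
    by_cases h1 : k (s, j) < k (t, i)
    · rw [if_pos h1, if_neg (by omega), add_zero]
    · rw [if_neg h1, if_pos (by omega)]; rfl
  have e0 : ∀ j : Fin 3, ∀ f : Fin 3 → ZMod 2,
      ∑ m, (if m = j then 0 else f m) = f (j + 1) + f (j + 2) := by
    decide +kernel
  have e1 : ∀ t i s j, crossing k t i s j =
      ((if k (s, j + 1) < k (t, i + 1) then 1 else 0) +
        if k (s, j + 1) < k (t, i + 2) then 1 else 0) +
      ((if k (s, j + 2) < k (t, i + 1) then 1 else 0) +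
        if k (s, j + 2) < k (t, i + 2) then 1 else 0) := by
    intro t i s j
    rw [crossing, ← e0 j fun m => (if k (s, m) < k (t, i + 1) then 1 else 0) +
        if k (s, m) < k (t, i + 2) then 1 else 0]
    refine Finset.sum_congr rfl fun m _ => ?_
    by_cases hm : m = j <;> simp [hm]
  rw [e1, e1, h, h, h, h]
  have : (1 : ZMod 2) + 1 = 0 := rfl
  linear_combination 2 * this

theorem sum_crossing {ι : Type*} (k : ι × Fin 3 → ℤ) (t s : ι) (j : Fin 3) :
    ∑ i, crossing k t i s j = 0 := by
  have e0 : ∀ f : Fin 3 → ZMod 2, ∑ i, (f (i + 1) + f (i + 2)) = 0 := by decide +kernel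
  simp only [crossing]
  rw [Finset.sum_comm]
  exact Finset.sum_eq_zero fun m _ =>
    e0 fun i => if k (s, m) < k (t, i) then if m = j then 0 else 1 else 0

theorem sum_sum_prod_vertexWeight {ι : Type*} [Fintype ι] [DecidableEq ι] {k : ι × Fin 3 → ℤ}
    (hk : Function.Injective k) :
    ∑ σ : ι → Equiv.Perm (Fin 3), ∑ δ : ι × Fin 3 → ZMod 2,
      ∏ c, vertexWeight (prefixSum k δ c) (δ c) (σ c.1 c.2) = 1 := by
  rw [Finset.sum_comm]
  have h1 : ∀ δ : ι × Fin 3 → ZMod 2,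
      ∑ σ : ι → Equiv.Perm (Fin 3), ∏ c, vertexWeight (prefixSum k δ c) (δ c) (σ c.1 c.2) =
      ∑ z : ι → Fin 3, ∏ t, if (fun i => δ (t, i)) = fun i => if i = z t then 0 else 1 then
        prefixSum k δ (t, z t + 1) + prefixSum k δ (t, z t + 2) else 0 := by
    intro δ
    simp only [Fintype.prod_prod_type]
    have := Finset.prod_univ_sum (fun _ : ι => (Finset.univ : Finset (Equiv.Perm (Fin 3))))
      (fun t σ => ∏ i, vertexWeight (prefixSum k δ (t, i)) (δ (t, i)) (σ i))
    rw [Fintype.piFinset_univ] at this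
    rw [← this]
    simp only [sum_perm_prod_vertexWeight (fun i => prefixSum k δ (_, i)) (fun i => δ (_, i))]
    rw [Finset.prod_univ_sum, Fintype.piFinset_univ]
  simp only [h1]
  rw [Finset.sum_comm]
  refine Eq.trans ?_ (sum_prod_sum_eq_one (crossing k) (crossing_self hk) (crossing_comm hk)
    (fun t s j _ => sum_crossing k t s j))
  refine Finset.sum_congr rfl fun z _ => ?_
  rw [Finset.sum_eq_single (fun c : ι × Fin 3 => if c.2 = z c.1 then 0 else 1)]
  · refine Finset.prod_congr rfl fun t _ => ?_
    rw [if_pos rfl, prefixSum, prefixSum, ← Finset.sum_add_distrib, Fintype.sum_prod_type]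
    rfl
  · intro δ _ hδ
    obtain ⟨⟨t, i⟩, hc⟩ := Function.ne_iff.1 hδ
    exact Finset.prod_eq_zero (Finset.mem_univ t) (if_neg fun h => hc (congrFun h i))
  · simp

theorem exists_rainbow_of_injective {ι : Type*} [Fintype ι] [DecidableEq ι] {k : ι × Fin 3 → ℤ}
    (hk : Function.Injective k) :
    ∃ σ : ι → Equiv.Perm (Fin 3), ∀ a b, k b = k a + 1 → σ a.1 a.2 ≠ σ b.1 b.2 := by
  by_contra! h
  refine zero_ne_one (α := ZMod 2) ?_
  rw [← sum_sum_prod_vertexWeight hk]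
  refine (Finset.sum_eq_zero fun σ _ => ?_).symm
  obtain ⟨a, b, hab, hx⟩ := h σ
  exact sum_prod_vertexWeight_eq_zero k hk (fun c => σ c.1 c.2) hab hx

/-- Every vertex has at most two neighbours. -/
def AtMostTwoNeighbors {V : Type*} (G : SimpleGraph V) : Prop :=
  ∀ v a b c, G.Adj v a → G.Adj v b → G.Adj v c → a = b ∨ a = c ∨ b = c

theorem exists_reachable_leaf {V : Type*} [Finite V] {G : SimpleGraph V} (hG : G.IsAcyclic)
    (u : V) : ∃ v, G.Reachable u v ∧ ∀ a b, G.Adj v a → G.Adj v b → a = b := by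
  obtain ⟨v, hv, hmax⟩ := (Set.toFinite {v | G.Reachable u v}).exists_maximalFor
    (fun v => G.dist u v) _ ⟨u, SimpleGraph.Reachable.refl u⟩
  refine ⟨v, hv, ?_⟩
  obtain ⟨p, hp, -⟩ := SimpleGraph.Reachable.exists_path_of_dist hv
  suffices h : ∀ a, G.Adj v a → a = p.penultimate from fun a b ha hb =>
    (h a ha).trans (h b hb).symm
  intro a ha
  have hua : G.Reachable u a := SimpleGraph.Reachable.trans hv ha.reachable
  obtain ⟨q, hq, hql⟩ := hua.exists_path_of_dist
  refine hG.eq_penultimate_of_adj_end hp ha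
    (hG.mem_support_of_ne_mem_support_of_adj_of_isPath hp hq ha fun hvq => ?_)
  classical
  have h1 := (SimpleGraph.dist_le (q.takeUntil v hvq)).trans (q.length_takeUntil_le_length hvq)
  have h2 : G.dist u a ≤ G.dist u v := by
    by_contra! h
    exact absurd (hmax hua h.le) (not_le.2 h)
  exact hG.dist_ne_of_adj ha hv (by omega)

theorem dist_injective_of_leaf {V : Type*} {G : SimpleGraph V} (hconn : G.Connected)
    (hG : AtMostTwoNeighbors G) {r : V} (hr : ∀ a b, G.Adj r a → G.Adj r b → a = b) :
    Function.Injective (G.dist r) := by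
  have hparent : ∀ n u, G.dist r u = n + 1 → ∃ p, G.Adj p u ∧ G.dist r p = n := by
    intro n u hu
    obtain ⟨p, hp⟩ := hconn.exists_walk_length_eq_dist r u
    have hnil : ¬ p.Nil := by
      rw [← SimpleGraph.Walk.length_eq_zero_iff]
      omega
    have hadj := p.adj_penultimate hnil
    refine ⟨_, hadj, ?_⟩
    have h1 := SimpleGraph.dist_le p.dropLast
    have h2 : p.dropLast.length + 1 = p.length := by
      rw [SimpleGraph.Walk.length_dropLast]
      omega
    have h3 := hadj.diff_dist_adj (u := r)
    omega
  have key : ∀ n u v, G.dist r u = n → G.dist r v = n → u = v := by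
    intro n
    induction n with
    | zero =>
      intro u v hu hv
      rw [hconn.dist_eq_zero_iff] at hu hv
      exact hu.symm.trans hv
    | succ n ih =>
      intro u v hu hv
      obtain ⟨p, hpu, hp⟩ := hparent n u hu
      obtain ⟨q, hqv, hq⟩ := hparent n v hv
      obtain rfl := ih p q hp hq
      rcases n with _ | n
      · rw [hconn.dist_eq_zero_iff] at hp
        subst hp
        exact hr _ _ hpu hqv
      · obtain ⟨s, hsp, hs⟩ := hparent n p hp
        rcases hG p u v s hpu hqv hsp.symm with h | h | h
        · exact h
        · subst h; omega
        · subst h; omega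
  exact fun u v h => key _ u v h rfl

theorem exists_connected_isAcyclic_ge {V : Type*} [Finite V] [Nonempty V] {G : SimpleGraph V}
    (hG : G.IsAcyclic) (hdeg : AtMostTwoNeighbors G) :
    ∃ T : SimpleGraph V, G ≤ T ∧ T.IsTree ∧ AtMostTwoNeighbors T := by
  obtain ⟨T, hGT, hT⟩ := Finite.exists_le_maximal
    (p := fun T : SimpleGraph V => T.IsAcyclic ∧ AtMostTwoNeighbors T) ⟨hG, hdeg⟩
  refine ⟨T, hGT, ⟨⟨fun u v => ?_⟩, hT.prop.1⟩, hT.prop.2⟩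
  by_contra huv
  obtain ⟨u', hu, hu'⟩ := exists_reachable_leaf hT.prop.1 u
  obtain ⟨v', hv, hv'⟩ := exists_reachable_leaf hT.prop.1 v
  have hnr : ¬ T.Reachable u' v' := fun h => huv ((hu.trans h).trans hv.symm)
  have hne : u' ≠ v' := by rintro rfl; exact hnr (SimpleGraph.Reachable.refl _)
  have hle := hT.le_of_ge (y := T ⊔ SimpleGraph.edge u' v')
    ⟨hT.prop.1.sup_edge_of_not_reachable hnr, ?_⟩ le_sup_left
  · exact hnr (hle (Or.inr (by simp [SimpleGraph.edge_adj, hne]))).reachable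
  · intro w a b c ha hb hc
    have hd := hT.prop.2 w a b c
    have h1 := hu' a b
    have h2 := hu' a c
    have h3 := hu' b c
    have h4 := hv' a b
    have h5 := hv' a c
    have h6 := hv' b c
    simp only [SimpleGraph.sup_adj, SimpleGraph.edge_adj] at ha hb hc
    grind

theorem exists_linear_order_of_isAcyclic {V : Type*} [Finite V] {G : SimpleGraph V}
    (hG : G.IsAcyclic) (hdeg : AtMostTwoNeighbors G) :
    ∃ k : V → ℕ, Function.Injective k ∧ ∀ u v, G.Adj u v → k u = k v + 1 ∨ k v = k u + 1 := by
  cases isEmpty_or_nonempty V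
  · exact ⟨fun _ => 0, Function.injective_of_subsingleton _, fun u => isEmptyElim u⟩
  obtain ⟨T, hGT, hT, hTdeg⟩ := exists_connected_isAcyclic_ge hG hdeg
  obtain ⟨r, -, hr⟩ := exists_reachable_leaf hT.isAcyclic (Classical.arbitrary V)
  exact ⟨T.dist r, dist_injective_of_leaf hT.connected hTdeg hr,
    fun u v huv => hT.dist_eq_dist_add_one_of_adj r (hGT huv)⟩

/-- The vertices of a linear forest can be coloured properly with three colours in such a way that
prescribed disjoint sets of at most three vertices, the fibres of `f`, become rainbow. -/
theorem exists_rainbow_coloring_of_isAcyclic {V ι : Type*} [Fintype V] [Finite ι]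
    {G : SimpleGraph V} (hG : G.IsAcyclic) (hdeg : AtMostTwoNeighbors G) (f : V → ι)
    (hf : ∀ t, Nat.card {v // f v = t} ≤ 3) :
    ∃ c : V → Fin 3, (∀ u v, G.Adj u v → c u ≠ c v) ∧
      ∀ u v, f u = f v → u ≠ v → c u ≠ c v := by
  classical
  have := Fintype.ofFinite ι
  obtain ⟨k, hk, hadj⟩ := exists_linear_order_of_isAcyclic hG hdeg
  have hemb : ∀ t, Nonempty ({v // f v = t} ↪ Fin 3) := fun t =>
    Function.Embedding.nonempty_of_card_le (by simpa [Nat.card_eq_fintype_card] using hf t)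
  let g : V → ι × Fin 3 := fun v => (f v, (hemb (f v)).some ⟨v, rfl⟩)
  have hgi : ∀ u v t (hu : f u = t) (hv : f v = t), (hemb t).some ⟨u, hu⟩ = (hemb t).some ⟨v, hv⟩ →
      u = v := fun u v t hu hv h => congrArg Subtype.val ((hemb t).some.injective h)
  have hg1 : ∀ v t (h : f v = t), (g v).2 = (hemb t).some ⟨v, h⟩ := by
    rintro v _ rfl
    rfl
  have hg : Function.Injective g := fun u v h => by
    obtain ⟨h1, h2⟩ := Prod.ext_iff.1 h
    rw [hg1 u (f v) h1, hg1 v (f v) rfl] at h2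
    exact hgi _ _ _ _ _ h2
  let K : ι × Fin 3 → ℤ := Function.extend g (fun v => (k v : ℤ))
    (fun a => -1 - (Fintype.equivFin (ι × Fin 3) a : ℕ))
  have hKg : ∀ v, K (g v) = k v := fun v => hg.extend_apply _ _ v
  have hKn : ∀ a, (¬ ∃ v, g v = a) → K a = -1 - (Fintype.equivFin (ι × Fin 3) a : ℕ) :=
    fun a ha => Function.extend_apply' _ _ a ha
  have hK : Function.Injective K := by
    intro a b hab
    by_cases ha : ∃ v, g v = a <;> by_cases hb : ∃ v, g v = b
    · obtain ⟨u, rfl⟩ := ha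
      obtain ⟨v, rfl⟩ := hb
      rw [hKg, hKg] at hab
      exact congrArg g (hk (by exact_mod_cast hab))
    · obtain ⟨u, rfl⟩ := ha
      rw [hKg, hKn b hb] at hab
      omega
    · obtain ⟨v, rfl⟩ := hb
      rw [hKg, hKn a ha] at hab
      omega
    · rw [hKn a ha, hKn b hb] at hab
      exact (Fintype.equivFin _).injective (Fin.ext (by omega))
  obtain ⟨σ, hσ⟩ := exists_rainbow_of_injective hK
  refine ⟨fun v => σ (g v).1 (g v).2, fun u v huv => ?_, fun u v huv hne h => hne (hg ?_)⟩
  · rcases hadj u v huv with h | h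
    · exact (hσ (g v) (g u) (by rw [hKg, hKg, h]; push_cast; rfl)).symm
    · exact hσ (g u) (g v) (by rw [hKg, hKg, h]; push_cast; rfl)
  · have h1 : (g u).1 = (g v).1 := huv
    dsimp only at h
    rw [h1] at h
    exact Prod.ext h1 ((σ _).injective h)

theorem card_filter_add_card_filter_not_mem {V ι : Type*} [Fintype V] [DecidableEq V]
    [DecidableEq ι] (f : V → ι) (s : Finset V) (t : ι) :
    (s.filter fun v => f v = t).card + (Finset.univ.filter fun v => f v = t ∧ v ∉ s).card =
      (Finset.univ.filter fun v => f v = t).card := by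
  rw [← Finset.card_filter_add_card_filter_not (s := Finset.univ.filter fun v => f v = t) (· ∈ s)]
  congr 2 <;> ext v <;> simp [and_comm]

theorem IsCycleSet.card_eq_and_forall {V : Type} [DecidableEq V] {H : SimpleGraph V}
    {s : Finset V} (hs : IsCycleSet H s) :
    3 ≤ s.card ∧ ∀ v ∈ s, ∃ a ∈ s, ∃ b ∈ s, a ≠ b ∧ H.Adj v a ∧ H.Adj v b := by
  obtain ⟨u, w, hw, rfl⟩ := hs
  constructor
  · have h1 := hw.three_le_length
    have h2 : w.support.tail.toFinset ⊆ w.support.toFinset := fun x hx =>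
      List.mem_toFinset.2 (List.mem_of_mem_tail (List.mem_toFinset.1 hx))
    have h3 := Finset.card_le_card h2
    rw [List.toFinset_card_of_nodup hw.support_nodup] at h3
    simp only [List.length_tail, SimpleGraph.Walk.length_support] at h3
    omega
  · intro v hv
    obtain ⟨a, b, hab, heq⟩ := Set.ncard_eq_two.1
      (hw.ncard_neighborSet_toSubgraph_eq_two (List.mem_toFinset.1 hv))
    have ha : w.toSubgraph.Adj v a := by
      rw [← SimpleGraph.Subgraph.mem_neighborSet, heq]; simp
    have hb : w.toSubgraph.Adj v b := by
      rw [← SimpleGraph.Subgraph.mem_neighborSet, heq]; simp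
    exact ⟨a, List.mem_toFinset.2 (w.mem_verts_toSubgraph.1 ha.snd_mem), b,
      List.mem_toFinset.2 (w.mem_verts_toSubgraph.1 hb.snd_mem), hab, ha.adj_sub, hb.adj_sub⟩

theorem IsCycleSet.mem_of_adj {V : Type} [DecidableEq V] {H : SimpleGraph V}
    (hdeg : AtMostTwoNeighbors H) {s : Finset V} (hs : IsCycleSet H s) {v a : V} (hv : v ∈ s)
    (hva : H.Adj v a) : a ∈ s := by
  obtain ⟨b, hb, c, hc, hbc, hvb, hvc⟩ := hs.card_eq_and_forall.2 v hv
  rcases hdeg v a b c hva hvb hvc with rfl | rfl | h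
  exacts [hb, hc, absurd h hbc]

theorem IsCycleSet.subset_of_mem {V : Type} [DecidableEq V] {H : SimpleGraph V}
    (hdeg : AtMostTwoNeighbors H) {s s' : Finset V} (hs : IsCycleSet H s)
    (hs' : IsCycleSet H s') {v : V} (hv : v ∈ s) (hv' : v ∈ s') : s' ⊆ s := by
  have hwalk : ∀ {a b : V}, H.Walk a b → a ∈ s → b ∈ s := by
    intro a b p
    induction p with
    | nil => exact id
    | cons h _ ih => exact fun ha => ih (hs.mem_of_adj hdeg ha h)
  obtain ⟨u, w, hw, rfl⟩ := hs'
  intro x hx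
  exact hwalk (((w.takeUntil v (List.mem_toFinset.1 hv')).reverse).append
    (w.takeUntil x (List.mem_toFinset.1 hx))) hv

theorem IsCycleSet.eq_of_mem {V : Type} [DecidableEq V] {H : SimpleGraph V}
    (hdeg : AtMostTwoNeighbors H) {s s' : Finset V} (hs : IsCycleSet H s)
    (hs' : IsCycleSet H s') {v : V} (hv : v ∈ s) (hv' : v ∈ s') : s = s' :=
  (hs'.subset_of_mem hdeg hs hv' hv).antisymm (hs.subset_of_mem hdeg hs' hv hv')

theorem IsCycleSet.mono {V : Type} [DecidableEq V] {H H' : SimpleGraph V} (h : H ≤ H')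
    {s : Finset V} (hs : IsCycleSet H s) : IsCycleSet H' s := by
  obtain ⟨u, w, hw, rfl⟩ := hs
  exact ⟨u, w.mapLe h, hw.mapLe h, by simp⟩

theorem exists_rainbow_coloring_compl {V ι : Type} [Fintype V] [DecidableEq V] [DecidableEq ι]
    [Finite ι] {H : SimpleGraph V} (hdeg : AtMostTwoNeighbors H) (f : V → ι) (S : Finset V)
    (hS : ∀ s, IsCycleSet H s → ∃ r ∈ S, r ∈ s)
    (hf : ∀ t, (Finset.univ.filter fun v => f v = t ∧ v ∉ S).card ≤ 3) :
    ∃ c : V → Fin 3, ∀ u v, u ∉ S → v ∉ S → H.Adj u v ∨ f u = f v ∧ u ≠ v → c u ≠ c v := by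
  have hacyc : (H.induce {v | v ∉ S}).IsAcyclic := by
    intro u w hw
    obtain ⟨r, hrS, hr⟩ := hS _ ⟨_, w.map (SimpleGraph.Embedding.induce _).toHom,
      hw.map (SimpleGraph.Embedding.induce (G := H) {v | v ∉ S}).injective, rfl⟩
    rw [List.mem_toFinset, SimpleGraph.Walk.support_map, List.mem_map] at hr
    obtain ⟨x, -, rfl⟩ := hr
    exact x.2 hrS
  obtain ⟨c, hc1, hc2⟩ := exists_rainbow_coloring_of_isAcyclic hacyc
    (fun v a b c ha hb hc => by
      rcases hdeg v a b c ha hb hc with h | h | h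
      exacts [Or.inl (Subtype.ext h), Or.inr (Or.inl (Subtype.ext h)),
        Or.inr (Or.inr (Subtype.ext h))])
    (fun v => f v) (fun t => by
      refine le_trans ?_ (hf t)
      rw [Nat.card_eq_fintype_card, ← Fintype.card_coe]
      refine Fintype.card_le_of_injective
        (fun v => ⟨v.1.1, by simpa using ⟨v.2, v.1.2⟩⟩) fun u v h => ?_
      simpa [Subtype.ext_iff] using h)
  refine ⟨fun v => if h : v ∉ S then c ⟨v, h⟩ else 0, fun u v hu hv h => ?_⟩
  simp only [dif_pos hu, dif_pos hv]
  rcases h with h | ⟨h, hne⟩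
  · exact hc1 ⟨u, hu⟩ ⟨v, hv⟩ h
  · exact hc2 ⟨u, hu⟩ ⟨v, hv⟩ h fun h' => hne (congrArg Subtype.val h')

/-- `R` is an independent set of `H` meeting each fibre of `f` at most once, and meeting the fibres
of size four. -/
structure IsPartialTransversal {V ι : Type} [Fintype V] [DecidableEq ι] (H : SimpleGraph V)
    (f : V → ι) (R : Finset V) : Prop where
  indep : ∀ u ∈ R, ∀ v ∈ R, ¬ H.Adj u v
  injOn : ∀ u ∈ R, ∀ v ∈ R, f u = f v → u = v
  meets : ∀ t, (Finset.univ.filter fun v => f v = t).card = 4 → ∃ v ∈ R, f v = t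

theorem exists_isPartialTransversal {V ι : Type} [Fintype V] [DecidableEq V] [DecidableEq ι]
    [Finite ι] {H : SimpleGraph V} (hdeg : AtMostTwoNeighbors H) (f : V → ι)
    (hf : ∀ t, (Finset.univ.filter fun v => f v = t).card ≤ 4) (R₀ : Finset V)
    (hinj : ∀ u ∈ R₀, ∀ v ∈ R₀, f u = f v → u = v)
    (hhit : ∀ s, IsCycleSet H s → ∃ r ∈ R₀, r ∈ s) :
    ∃ R : Finset V, IsPartialTransversal H f R := by
  have hg : ∀ t : Set.range f, ∃ x, f x = t ∧ ∀ r ∈ R₀, f r = t → r = x := by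
    rintro ⟨_, v, rfl⟩
    by_cases h : ∃ r ∈ R₀, f r = f v
    · obtain ⟨r, hr, hrv⟩ := h
      exact ⟨r, hrv, fun r' hr' h' => hinj r' hr' r hr (h'.trans hrv.symm)⟩
    · exact ⟨v, rfl, fun r hr hrv => absurd ⟨r, hr, hrv⟩ h⟩
  choose g hg1 hg2 using hg
  let S : Finset V := Finset.univ.filter fun v => v = g ⟨f v, v, rfl⟩
  have hSfib : ∀ t : Set.range f, (S.filter fun v => f v = t) = {g t} := by
    intro t
    ext v
    simp only [S, Finset.mem_filter, Finset.mem_univ, true_and, Finset.mem_singleton]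
    constructor
    · rintro ⟨h1, h2⟩
      rw [h1]
      congr 1
      exact Subtype.ext h2
    · rintro rfl
      refine ⟨?_, hg1 t⟩
      congr 1
      exact Subtype.ext (hg1 t).symm
  have hcard : ∀ t : Set.range f, (Finset.univ.filter fun v => f v = t ∧ v ∉ S).card + 1 =
      (Finset.univ.filter fun v => f v = t).card := by
    intro t
    rw [← card_filter_add_card_filter_not_mem f S t, hSfib, Finset.card_singleton, add_comm]
  obtain ⟨c, hc⟩ := exists_rainbow_coloring_compl hdeg f S
    (fun s hs => by
      obtain ⟨r, hr, hrs⟩ := hhit s hs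
      exact ⟨r, by simpa [S] using hg2 ⟨f r, r, rfl⟩ r hr rfl, hrs⟩)
    (fun t => by
      by_cases ht : t ∈ Set.range f
      · have h1 := hcard ⟨t, ht⟩
        have h2 := hf t
        dsimp only at h1
        omega
      · rw [Finset.filter_false_of_mem fun v _ h => ht ⟨v, h.1⟩]
        simp)
  refine ⟨Finset.univ.filter fun v => v ∉ S ∧ c v = 0, ?_, ?_, ?_⟩
  · intro u hu v hv huv
    simp only [Finset.mem_filter, Finset.mem_univ, true_and] at hu hv
    exact hc u v hu.1 hv.1 (Or.inl huv) (hu.2.trans hv.2.symm)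
  · intro u hu v hv huv
    simp only [Finset.mem_filter, Finset.mem_univ, true_and] at hu hv
    by_contra hne
    exact hc u v hu.1 hv.1 (Or.inr ⟨huv, hne⟩) (hu.2.trans hv.2.symm)
  · intro t ht
    have htr : t ∈ Set.range f := by
      obtain ⟨v, hv⟩ := Finset.card_pos.1 (by omega : 0 < (Finset.univ.filter fun v => f v = t).card)
      exact ⟨v, (Finset.mem_filter.1 hv).2⟩
    have h3 := hcard ⟨t, htr⟩
    dsimp only at h3
    set A := Finset.univ.filter fun v => f v = t ∧ v ∉ S with hA
    have hmem : ∀ v, v ∈ A ↔ f v = t ∧ v ∉ S := fun v => by simp [hA]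
    have hcA : Set.InjOn c A := by
      intro u hu v hv huv
      obtain ⟨hu1, hu2⟩ := (hmem u).1 hu
      obtain ⟨hv1, hv2⟩ := (hmem v).1 hv
      by_contra hne
      exact hc u v hu2 hv2 (Or.inr ⟨hu1.trans hv1.symm, hne⟩) huv
    have himg : A.image c = Finset.univ := by
      rw [← Finset.card_eq_iff_eq_univ, Finset.card_image_of_injOn hcA, Fintype.card_fin]
      omega
    obtain ⟨v, hv, hv0⟩ := Finset.mem_image.1 (himg ▸ Finset.mem_univ (0 : Fin 3))
    exact ⟨v, by simpa using ⟨((hmem v).1 hv).2, hv0⟩, ((hmem v).1 hv).1⟩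

theorem exists_isPartialTransversal_hitting {V ι : Type} [Fintype V] [DecidableEq V]
    [DecidableEq ι] [Finite ι] {H : SimpleGraph V} (hdeg : AtMostTwoNeighbors H) (f : V → ι)
    (hf : ∀ t, (Finset.univ.filter fun v => f v = t).card ≤ 4) (R₀ : Finset V)
    (hinj : ∀ u ∈ R₀, ∀ v ∈ R₀, f u = f v → u = v)
    (hhit : ∀ s, IsCycleSet H s → ∃ r ∈ R₀, r ∈ s) :
    ∃ R : Finset V, IsPartialTransversal H f R ∧ ∀ s, IsCycleSet H s → ∃ r ∈ R, r ∈ s := by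
  obtain ⟨R, hR, hmax⟩ := (Set.toFinite {R | IsPartialTransversal H f R}).exists_maximalFor
    (fun R => R ∩ R₀) _ (exists_isPartialTransversal hdeg f hf R₀ hinj hhit)
  replace hR : IsPartialTransversal H f R := hR
  refine ⟨R, hR, fun s hs => ?_⟩
  by_contra! hRs
  obtain ⟨r, hr, hrs⟩ := hhit s hs
  have hadj : ∀ u ∈ R, ¬ H.Adj r u := fun u hu h => hRs u hu (hs.mem_of_adj hdeg hrs h)
  let R' := insert r (R.filter fun v => f v ≠ f r)
  have hR' : IsPartialTransversal H f R' := by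
    refine ⟨fun u hu v hv huv => ?_, fun u hu v hv huv => ?_, fun t ht => ?_⟩
    · simp only [R', Finset.mem_insert, Finset.mem_filter] at hu hv
      rcases hu with rfl | hu <;> rcases hv with rfl | hv
      · exact huv.ne rfl
      · exact hadj v hv.1 huv
      · exact hadj u hu.1 huv.symm
      · exact hR.indep u hu.1 v hv.1 huv
    · simp only [R', Finset.mem_insert, Finset.mem_filter] at hu hv
      rcases hu with rfl | hu <;> rcases hv with rfl | hv
      · rfl
      · exact absurd huv.symm hv.2
      · exact absurd huv hu.2
      · exact hR.injOn u hu.1 v hv.1 huv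
    · by_cases h : t = f r
      · exact ⟨r, Finset.mem_insert_self _ _, h.symm⟩
      · obtain ⟨v, hv, rfl⟩ := hR.meets t ht
        exact ⟨v, Finset.mem_insert_of_mem (Finset.mem_filter.2 ⟨hv, h⟩), rfl⟩
  have hle : R ∩ R₀ ≤ R' ∩ R₀ := by
    intro x hx
    obtain ⟨hxR, hx0⟩ := Finset.mem_inter.1 hx
    refine Finset.mem_inter.2 ⟨Finset.mem_insert_of_mem (Finset.mem_filter.2 ⟨hxR, fun h => ?_⟩),
      hx0⟩
    obtain rfl := hinj x hx0 r hr h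
    exact hRs x hxR hrs
  have hrR := hmax hR' hle (Finset.mem_inter.2 ⟨Finset.mem_insert_self _ _, hr⟩)
  exact hRs r (Finset.mem_inter.1 hrR).1 hrs

theorem exists_rainbow_coloring_of_hits {V ι : Type} [Fintype V] [DecidableEq V]
    [DecidableEq ι] [Finite ι] {H : SimpleGraph V} (hdeg : AtMostTwoNeighbors H) (f : V → ι)
    (hf : ∀ t, (Finset.univ.filter fun v => f v = t).card ≤ 4) (R₀ : Finset V)
    (hinj : ∀ u ∈ R₀, ∀ v ∈ R₀, f u = f v → u = v)
    (hhit : ∀ s, IsCycleSet H s → ∃ r ∈ R₀, r ∈ s) :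
    ∃ c : V → Fin 4, ∀ u v, H.Adj u v ∨ f u = f v ∧ u ≠ v → c u ≠ c v := by
  obtain ⟨R, hR, hRhit⟩ := exists_isPartialTransversal_hitting hdeg f hf R₀ hinj hhit
  obtain ⟨c, hc⟩ := exists_rainbow_coloring_compl hdeg f R hRhit (fun t => by
    have h1 := card_filter_add_card_filter_not_mem f R t
    have h2 := hf t
    by_cases h4 : (Finset.univ.filter fun v => f v = t).card = 4
    · obtain ⟨v, hv, hvt⟩ := hR.meets t h4
      have h3 : 0 < (R.filter fun v => f v = t).card :=
        Finset.card_pos.2 ⟨v, Finset.mem_filter.2 ⟨hv, hvt⟩⟩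
      omega
    · omega)
  refine ⟨fun v => if v ∈ R then Fin.last 3 else (c v).castSucc, fun u v h => ?_⟩
  by_cases hu : u ∈ R <;> by_cases hv : v ∈ R
  · rcases h with h | ⟨h, hne⟩
    · exact absurd h (hR.indep u hu v hv)
    · exact absurd (hR.injOn u hu v hv h) hne
  · simpa [hu, hv] using (Fin.castSucc_lt_last (c v)).ne'
  · simpa [hu, hv] using (Fin.castSucc_lt_last (c u)).ne
  · simpa [hu, hv] using hc u v hu hv h

theorem AtMostTwoNeighbors.of_degree_le {V : Type*} [Fintype V] [DecidableEq V]
    {H : SimpleGraph V} [DecidableRel H.Adj] (hΔ : ∀ v, H.degree v ≤ 2) :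
    AtMostTwoNeighbors H := by
  intro v a b c ha hb hc
  by_contra! h
  have hsub : ({a, b, c} : Finset V) ⊆ H.neighborFinset v := by
    intro x hx
    simp only [Finset.mem_insert, Finset.mem_singleton] at hx
    rw [SimpleGraph.mem_neighborFinset]
    rcases hx with rfl | rfl | rfl <;> assumption
  have h1 := Finset.card_le_card hsub
  rw [SimpleGraph.card_neighborFinset_eq_degree,
    Finset.card_eq_three.2 ⟨a, b, c, h.1, h.2.1, h.2.2, rfl⟩] at h1
  exact absurd (h1.trans (hΔ v)) (by norm_num)

theorem sum_card_eq_card_biUnion_of_isCycleSet {V : Type} [Fintype V] [DecidableEq V]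
    {H : SimpleGraph V}
    (hdeg : AtMostTwoNeighbors H) (S : Finset (Finset V)) (hS : ∀ s ∈ S, IsCycleSet H s) :
    ∑ s ∈ S, s.card = (S.biUnion id).card := by
  rw [Finset.card_biUnion]
  · rfl
  · intro s hs s' hs' hne
    change Disjoint s s'
    rw [Finset.disjoint_left]
    exact fun v hv hv' => hne ((hS s hs).eq_of_mem hdeg (hS s' hs') hv hv')

theorem three_mul_ncard_triangles_le {V : Type} [Fintype V] [DecidableEq V] {H : SimpleGraph V}
    (hdeg : AtMostTwoNeighbors H) :
    3 * {s : Finset V | IsCycleSet H s ∧ s.card = 3}.ncard ≤ Fintype.card V := by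
  classical
  rw [Set.ncard_eq_toFinset_card']
  set S := {s : Finset V | IsCycleSet H s ∧ s.card = 3}.toFinset with hSdef
  have hS : ∀ s ∈ S, IsCycleSet H s ∧ s.card = 3 := fun s hs => by simpa [hSdef] using hs
  have h1 := sum_card_eq_card_biUnion_of_isCycleSet hdeg S fun s hs => (hS s hs).1
  rw [Finset.sum_congr rfl fun s hs => (hS s hs).2, Finset.sum_const, smul_eq_mul, mul_comm] at h1
  exact h1.trans_le (Finset.card_le_univ _)

theorem card_le_card_image_add {V ι : Type} [Fintype V] [DecidableEq V] [DecidableEq ι]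
    {H : SimpleGraph V} (hdeg : AtMostTwoNeighbors H) (f : V → ι)
    (hf : ∀ t, (Finset.univ.filter fun v => f v = t).card ≤ 4) (S : Finset (Finset V))
    (hS : ∀ s ∈ S, IsCycleSet H s) :
    S.card ≤ ((S.biUnion id).image f).card +
      {s : Finset V | IsCycleSet H s ∧ s.card = 3}.ncard / 4 := by
  have h1 := sum_card_eq_card_biUnion_of_isCycleSet hdeg S hS
  have h2 : (S.biUnion id).card ≤ 4 * ((S.biUnion id).image f).card :=
    Finset.card_le_mul_card_image _ 4 fun t _ =>
      (Finset.card_le_card (Finset.filter_subset_filter _ (Finset.subset_univ _))).trans (hf t)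
  have h3 : (S.filter fun s => s.card = 3).card ≤
      {s : Finset V | IsCycleSet H s ∧ s.card = 3}.ncard := by
    rw [← Set.ncard_coe_finset]
    refine Set.ncard_le_ncard (fun s hs => ?_) (Set.toFinite _)
    obtain ⟨hs, h⟩ := Finset.mem_filter.1 hs
    exact ⟨hS s hs, h⟩
  have h4 : S.card * 4 ≤ ∑ s ∈ S, (s.card + if s.card = 3 then 1 else 0) := by
    rw [← smul_eq_mul, ← Finset.sum_const]
    refine Finset.sum_le_sum fun s hs => ?_
    have := (hS s hs).card_eq_and_forall.1
    split_ifs <;> omega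
  rw [Finset.sum_add_distrib, ← Finset.card_filter] at h4
  omega

/-- All but a quarter of the number of triangles of the cycles have representatives in distinct
fibres of `f`. -/
theorem exists_cycle_representatives {V ι : Type} [Fintype V] [DecidableEq V] [DecidableEq ι]
    {H : SimpleGraph V} (hdeg : AtMostTwoNeighbors H) (f : V → ι)
    (hf : ∀ t, (Finset.univ.filter fun v => f v = t).card ≤ 4) :
    ∃ Z R : Finset V,
      Z.card ≤ {s : Finset V | IsCycleSet H s ∧ s.card = 3}.ncard / 4 ∧
      (∀ s, IsCycleSet H s → (Z ∩ s).card ≤ 1) ∧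
      (∀ u ∈ R, ∀ v ∈ R, f u = f v → u = v) ∧
      ∀ s, IsCycleSet H s → (∃ z ∈ Z, z ∈ s) ∨ ∃ r ∈ R, r ∈ s := by
  classical
  set d := {s : Finset V | IsCycleSet H s ∧ s.card = 3}.ncard / 4 with hd
  obtain ⟨m, hm, hmem⟩ := (Finset.all_card_le_biUnion_card_iff_exists_injective
    (fun s : {s : Finset V // IsCycleSet H s} =>
      (s.1.image f).disjSum (Finset.univ : Finset (Fin d)))).1 (by
    intro S
    rcases S.eq_empty_or_nonempty with rfl | ⟨s₀, hs₀⟩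
    · simp
    have h1 := card_le_card_image_add hdeg f hf (S.map (Function.Embedding.subtype _))
      (fun s hs => by
        obtain ⟨x, -, rfl⟩ := Finset.mem_map.1 hs
        exact x.2)
    rw [Finset.card_map] at h1
    refine h1.trans ?_
    rw [← hd]
    have h2 : (((S.map (Function.Embedding.subtype _)).biUnion id).image f).disjSum
        (Finset.univ : Finset (Fin d)) ⊆
        S.biUnion fun s => (s.1.image f).disjSum (Finset.univ : Finset (Fin d)) := by
      intro y hy
      rw [Finset.mem_biUnion]
      rcases Finset.mem_disjSum.1 hy with ⟨t, ht, rfl⟩ | ⟨i, -, rfl⟩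
      · obtain ⟨v, hv, rfl⟩ := Finset.mem_image.1 ht
        obtain ⟨_, hs', hvs⟩ := Finset.mem_biUnion.1 hv
        obtain ⟨s, hs, rfl⟩ := Finset.mem_map.1 hs'
        exact ⟨s, hs, Finset.inl_mem_disjSum.2 (Finset.mem_image_of_mem f hvs)⟩
      · exact ⟨s₀, hs₀, Finset.inr_mem_disjSum.2 (Finset.mem_univ _)⟩
    refine le_trans ?_ (Finset.card_le_card h2)
    rw [Finset.card_disjSum, Finset.card_univ, Fintype.card_fin])
  have hx : ∀ s : {s : Finset V // IsCycleSet H s}, ∃ x ∈ s.1, ∀ t, m s = Sum.inl t → f x = t := by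
    intro s
    rcases Finset.mem_disjSum.1 (hmem s) with ⟨t, ht, hst⟩ | ⟨i, -, hsi⟩
    · obtain ⟨v, hv, rfl⟩ := Finset.mem_image.1 ht
      exact ⟨v, hv, fun t h => Sum.inl_injective (hst.trans h)⟩
    · obtain ⟨v, hv⟩ := Finset.card_pos.1
        ((by norm_num : 0 < 3).trans_le s.2.card_eq_and_forall.1)
      exact ⟨v, hv, fun t h => by simp [← hsi] at h⟩
  choose x hxs hxf using hx
  refine ⟨(Finset.univ.filter fun s => (m s).isRight).image x,
    (Finset.univ.filter fun s => (m s).isLeft).image x, ?_, fun s hs => ?_, ?_, fun s hs => ?_⟩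
  · refine Finset.card_image_le.trans ?_
    rw [← Finset.card_map ⟨m, hm⟩]
    calc _ ≤ ((Finset.univ : Finset (Fin d)).map Function.Embedding.inr).card :=
          Finset.card_le_card fun y hy => by
            obtain ⟨s, hs, rfl⟩ := Finset.mem_map.1 hy
            obtain ⟨i, hi⟩ := Sum.isRight_iff.1 (Finset.mem_filter.1 hs).2
            exact Finset.mem_map.2 ⟨i, Finset.mem_univ _, hi.symm⟩
      _ = d := by simp
  · refine Finset.card_le_one.2 fun a ha b hb => ?_
    obtain ⟨ha, has⟩ := Finset.mem_inter.1 ha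
    obtain ⟨hb, hbs⟩ := Finset.mem_inter.1 hb
    obtain ⟨s₁, -, rfl⟩ := Finset.mem_image.1 ha
    obtain ⟨s₂, -, rfl⟩ := Finset.mem_image.1 hb
    have h1 := s₁.2.eq_of_mem hdeg hs (hxs s₁) has
    have h2 := s₂.2.eq_of_mem hdeg hs (hxs s₂) hbs
    exact congrArg x (Subtype.ext (h1.trans h2.symm))
  · intro u hu v hv huv
    obtain ⟨s₁, hs₁, rfl⟩ := Finset.mem_image.1 hu
    obtain ⟨s₂, hs₂, rfl⟩ := Finset.mem_image.1 hv
    obtain ⟨t₁, ht₁⟩ := Sum.isLeft_iff.1 (Finset.mem_filter.1 hs₁).2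
    obtain ⟨t₂, ht₂⟩ := Sum.isLeft_iff.1 (Finset.mem_filter.1 hs₂).2
    rw [hxf s₁ t₁ ht₁, hxf s₂ t₂ ht₂] at huv
    exact congrArg x (hm (ht₁.trans (huv ▸ ht₂.symm)))
  · cases h : m ⟨s, hs⟩ with
    | inl t =>
      exact Or.inr ⟨_, Finset.mem_image_of_mem x (Finset.mem_filter.2
        ⟨Finset.mem_univ ⟨s, hs⟩, by rw [h]; rfl⟩), hxs _⟩
    | inr i =>
      exact Or.inl ⟨_, Finset.mem_image_of_mem x (Finset.mem_filter.2
        ⟨Finset.mem_univ ⟨s, hs⟩, by rw [h]; rfl⟩), hxs _⟩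

theorem exists_fibers_of_gluedK4 {V : Type} [Fintype V] [DecidableEq V] {H G : SimpleGraph V}
    (hglue : GluedK4 H G) :
    ∃ (q : ℕ) (f : V → Fin q ⊕ V),
      (∀ t, (Finset.univ.filter fun v => f v = t).card ≤ 4) ∧
      ∀ u v, G.Adj u v → H.Adj u v ∨ f u = f v ∧ u ≠ v := by
  classical
  obtain ⟨q, Y, hcard, hdisj, hadj⟩ := hglue
  let f : V → Fin q ⊕ V := fun v => if h : ∃ j, v ∈ Y j then Sum.inl h.choose else Sum.inr v
  have hmem : ∀ v j, f v = Sum.inl j ↔ v ∈ Y j := by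
    intro v j
    by_cases h : ∃ j, v ∈ Y j
    · have hfv : f v = Sum.inl h.choose := dif_pos h
      rw [hfv, Sum.inl.injEq]
      constructor
      · rintro rfl
        exact h.choose_spec
      · intro hj
        by_contra hne
        exact Finset.disjoint_left.1 (hdisj _ _ hne) h.choose_spec hj
    · have hfv : f v = Sum.inr v := dif_neg h
      rw [hfv]
      simp only [reduceCtorEq, false_iff]
      exact fun hj => h ⟨j, hj⟩
  have hinr : ∀ v w, f v = Sum.inr w → v = w := by
    intro v w h
    by_cases h' : ∃ j, v ∈ Y j
    · simp [f, h'] at h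
    · simpa [f, h'] using h
  refine ⟨q, f, fun t => ?_, fun u v huv => ?_⟩
  · rcases t with j | w
    · simp only [hmem, Finset.filter_univ_mem, hcard, le_refl]
    · refine le_trans (Finset.card_le_card (t := {w}) fun v hv => ?_) (by simp)
      exact Finset.mem_singleton.2 (hinr v w (Finset.mem_filter.1 hv).2)
  · refine ((hadj u v).1 huv).imp_right ?_
    rintro ⟨hne, j, hu, hv⟩
    exact ⟨((hmem u j).2 hu).trans ((hmem v j).2 hv).symm, hne⟩

theorem stmt_10 {V : Type} [Fintype V] [DecidableEq V]
    (H G : SimpleGraph V) [DecidableRel H.Adj]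
    (hΔ : ∀ v, H.degree v ≤ 2)
    (hglue : GluedK4 H G) :
    ∃ Z : Finset V,
      -- |Z| ≤ |𝒯|/4 where 𝒯 is the set of triangles of H
      (Z.card : ℚ) ≤ ({s : Finset V | IsCycleSet H s ∧ s.card = 3}.ncard : ℚ) / 4 ∧
      -- Z contains at most one vertex from each cycle of H
      (∀ s : Finset V, IsCycleSet H s → (Z ∩ s).card ≤ 1) ∧
      -- χ(G − Z) ≤ 4
      (G.induce ((↑Z : Set V)ᶜ)).chromaticNumber ≤ 4 ∧
      -- |V(G) \ Z| ≥ (11/12)|V(G)|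
      (11 : ℚ) / 12 * (Fintype.card V : ℚ) ≤ ((Zᶜ : Finset V).card : ℚ) := by
  have hdeg := AtMostTwoNeighbors.of_degree_le hΔ
  obtain ⟨q, f, hf, hG⟩ := exists_fibers_of_gluedK4 hglue
  obtain ⟨Z, R, hZ, hZs, hR, hhit⟩ := exists_cycle_representatives hdeg f hf
  have hZ4 : 4 * Z.card ≤ {s : Finset V | IsCycleSet H s ∧ s.card = 3}.ncard := by omega
  refine ⟨Z, ?_, hZs, ?_, ?_⟩
  · rw [le_div_iff₀ (by norm_num), mul_comm]
    exact_mod_cast hZ4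
  · let H' : SimpleGraph V :=
      { Adj u v := H.Adj u v ∧ u ∉ Z ∧ v ∉ Z
        symm := ⟨fun _ _ h => ⟨h.1.symm, h.2.2, h.2.1⟩⟩
        loopless := ⟨fun _ h => h.1.ne rfl⟩ }
    have hle : H' ≤ H := fun _ _ h => h.1
    obtain ⟨c, hc⟩ := exists_rainbow_coloring_of_hits (H := H')
      (fun v a b c ha hb hc => hdeg v a b c ha.1 hb.1 hc.1) f hf R hR (fun s hs => by
        refine (hhit s (hs.mono hle)).resolve_left ?_
        rintro ⟨z, hz, hzs⟩
        obtain ⟨a, -, -, -, -, ha, -⟩ := hs.card_eq_and_forall.2 z hzs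
        exact ha.2.1 hz)
    refine SimpleGraph.Colorable.chromaticNumber_le
      ⟨SimpleGraph.Coloring.mk (fun v => c v) fun {u v} huv => hc u v ?_⟩
    exact (hG u v huv).imp_left fun h => ⟨h, u.2, v.2⟩
  · have h3 := three_mul_ncard_triangles_le hdeg
    have h12 : 12 * Z.card ≤ Fintype.card V := by omega
    rw [Finset.card_compl, Nat.cast_sub (Finset.card_le_univ Z)]
    have : (12 : ℚ) * Z.card ≤ Fintype.card V := by exact_mod_cast h12
    linarith
end
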